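/- arXiv:2310.19594 — 5 statements merged into one kernel-verified Lean document; each statement's English description precedes it below -/
import Mathlib

section
/- For every natural number n there exist a finite weighted graph G = (V, E, X) with at most C·n vertices (for an absolute constant C independent of n) and maximum degree at most 4, and a cut σ₀ of G, such that there is exactly one improving 1-flip sequence from σ₀ that ends in a local optimum, and this sequence has length at least 2^n. -/
open Finset
open scoped Classical

namespace MaxCut

variable {V : Type*} [Fintype V]

/-- The value of a cut `σ` in graph `G` with weights `X`. -/
noncomputable def cutValue (G : SimpleGraph V) (X : Sym2 V → ℝ) (σ : V → ℝ) : ℝ :=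
  (1 / 2) * ∑ e ∈ Finset.univ.filter (fun e => e ∈ G.edgeSet),
    (1 - Sym2.lift ⟨fun u w => σ u * σ w, fun u w => by ring⟩ e) * X e

/-- Flip the vertices of `S` across the cut. -/
noncomputable def flip (σ : V → ℝ) (S : Finset V) : V → ℝ := fun v => if v ∈ S then -σ v else σ v

/-- The change in cut value caused by flipping all vertices of `S`. -/
noncomputable def impr (G : SimpleGraph V) (X : Sym2 V → ℝ) (σ : V → ℝ) (S : Finset V) : ℝ :=
  cutValue G X (flip σ S) - cutValue G X σ

/-- The cut obtained from `σ` by performing all moves of the flip sequence. -/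
noncomputable def applyList (σ : V → ℝ) : List (Finset V) → (V → ℝ)
  | [] => σ
  | S :: L => applyList (flip σ S) L

/-- A flip sequence is improving from `σ` if each step strictly increases the cut value. -/
def Improving (G : SimpleGraph V) (X : Sym2 V → ℝ) : (V → ℝ) → List (Finset V) → Prop
  | _, [] => True
  | σ, S :: L => 0 < impr G X σ S ∧ Improving G X (flip σ S) L

/-- A cut assigns `1` or `-1` to each vertex. -/
def IsCut (σ : V → ℝ) : Prop := ∀ v, σ v = 1 ∨ σ v = -1

/-- A local optimum: no single-vertex flip is improving. -/
noncomputable def deg (G : SimpleGraph V) (v : V) : ℕ :=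
  (Finset.univ.filter (fun u => G.Adj v u)).card

def IsLocalOpt (G : SimpleGraph V) (X : Sym2 V → ℝ) (σ : V → ℝ) : Prop :=
  ∀ v : V, impr G X σ {v} ≤ 0

/-- Local field formula. -/
theorem impr_single (G : SimpleGraph V) (X : Sym2 V → ℝ) (σ : V → ℝ) (v : V) :
    impr G X σ {v} = ∑ u, if G.Adj v u then σ v * σ u * X s(v, u) else 0 := by
  unfold impr cutValue
  rw [← mul_sub, ← Finset.sum_sub_distrib, ← Finset.sum_filter]
  have hsub : (univ.filter (fun u => G.Adj v u)).image (fun u => s(v, u)) ⊆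
      univ.filter (fun e => e ∈ G.edgeSet) := by
    intro e he
    simp only [mem_image, mem_filter, mem_univ, true_and] at he ⊢
    obtain ⟨u, hu, rfl⟩ := he
    exact hu
  rw [← Finset.sum_subset hsub, Finset.sum_image, Finset.mul_sum]
  · apply Finset.sum_congr rfl
    intro u hu
    simp only [mem_filter, mem_univ, true_and] at hu
    have hne : u ≠ v := hu.ne'
    simp only [Sym2.lift_mk, flip, mem_singleton, if_true, hne, if_false]
    ring
  · intro a _ b _ h
    exact Sym2.congr_right.mp h
  · intro e he hne
    induction e using Sym2.ind with
    | _ a b =>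
      simp only [mem_filter, mem_univ, true_and, SimpleGraph.mem_edgeSet, mem_image,
        not_exists, not_and] at he hne
      have ha : a ≠ v := by
        rintro rfl
        exact hne b he rfl
      have hb : b ≠ v := by
        rintro rfl
        exact hne a he.symm Sym2.eq_swap
      simp [flip, ha, hb]

/-- States of the infinite array of modules. -/
abbrev St := ℕ → Fin 9 → ℤ

def gm (X y kid par : ℤ) (m : Fin 9 → ℤ) : Fin 9 → ℤ :=
  ![7 * (X - m 4 + m 6) + 6 * m 1,
    6 * m 0 + 3 * m 2 + m 3 - m 5,
    24 * (3 * m 1 + m 7) + kid,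
    24 * (17 * X + m 1 + 18 * m 4) + y,
    18 * m 3 - 7 * m 0 + 10 * m 5,
    24 * (10 * m 4 - m 1 + 11 * m 6) - y,
    11 * m 5 + 7 * m 0 + 3 * m 7,
    24 * (3 * m 6 + m 2 + 4 * m 8) + y,
    4 * m 7 + par]

def yy (s : St) : ℕ → ℤ
  | 0 => s 0 2
  | k + 1 => s k 8

def kid (s : St) : ℕ → ℤ
  | 0 => s 0 3 - s 0 5 + s 0 7
  | k + 1 => 7 * s k 0 + 17 * s k 3

def par (s : St) (k : ℕ) : ℤ := s (k + 1) 3 - s (k + 1) 5 + s (k + 1) 7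

def g (s : St) (k : ℕ) : Fin 9 → ℤ := gm (s (k + 1) 2) (yy s k) (kid s k) (par s k) (s k)

def Unst (s : St) (w : ℕ × Fin 9) : Prop := g s w.1 w.2 * s w.1 w.2 < 0

def flp (s : St) (w : ℕ × Fin 9) : St := fun i j => if (i, j) = w then - s i j else s i j

inductive Run : St → List (ℕ × Fin 9) → St → Prop
  | nil (s : St) : Run s [] s
  | cons (s : St) (v : ℕ × Fin 9) (L : List (ℕ × Fin 9)) (s' : St)
      (h : ∀ w, Unst s w ↔ w = v) (hr : Run (flp s v) L s') : Run s (v :: L) s'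

theorem Run.append {s s' s'' : St} {L L' : List (ℕ × Fin 9)} (h : Run s L s') (h' : Run s' L' s'') :
    Run s (L ++ L') s'' := by
  induction h with
  | nil => exact h'
  | cons s v L s' h hr ih => exact Run.cons _ _ _ _ h (ih h')

/-- Bounded states. -/
def Bd (s : St) : Prop := ∀ i j, -1 ≤ s i j ∧ s i j ≤ 1

theorem Bd.kid {s : St} (h : Bd s) (k : ℕ) : -24 ≤ kid s k ∧ kid s k ≤ 24 := by
  cases k with
  | zero =>
    have h1 := h 0 3; have h2 := h 0 5; have h3 := h 0 7
    simp only [MaxCut.kid]; omega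
  | succ k =>
    have h1 := h k 0; have h2 := h k 3
    simp only [MaxCut.kid]; omega

theorem Bd.par {s : St} (h : Bd s) (k : ℕ) : -3 ≤ par s k ∧ par s k ≤ 3 := by
  have h1 := h (k+1) 3; have h2 := h (k+1) 5; have h3 := h (k+1) 7
  simp only [MaxCut.par]; omega

def StepM (t : ℤ) (m : Fin 9 → ℤ) (j : Fin 9) : Prop :=
  ∀ kd pr : ℤ, (-24 ≤ kd ∧ kd ≤ 24) → (-3 ≤ pr ∧ pr ≤ 3) →
    ∀ i, gm (-t) (m 2) kd pr m i * m i < 0 ↔ i = j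

def CallM (t : ℤ) (m : Fin 9 → ℤ) : Prop :=
  ∀ kd pr : ℤ, (-24 ≤ kd ∧ kd ≤ 24) → (-3 ≤ pr ∧ pr ≤ 3) →
    ∀ i, ¬ gm (-t) (-(m 2)) kd pr m i * m i < 0

def pat (t : ℤ) (q : Fin 9 → ℤ) : Fin 9 → ℤ := fun j => t * q j

/-- A settled module is stable. -/
theorem settled_stable (c : ℤ) (hc : c = 1 ∨ c = -1) (kd pr : ℤ) (h1 : -24 ≤ kd ∧ kd ≤ 24)
    (h2 : -3 ≤ pr ∧ pr ≤ 3) (i : Fin 9) : ¬ gm c c kd pr (fun _ => c) i * c < 0 := by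
  rcases hc with rfl | rfl <;> fin_cases i <;> simp [gm] <;> omega

theorem sm0 (t : ℤ) (ht : t = 1 ∨ t = -1) : StepM t (pat t ![1,1,1,1,1,1,1,1,1]) 0 := by
  intro kd pr h1 h2 i
  rcases ht with rfl | rfl <;> fin_cases i <;> simp [gm, pat] <;> omega
theorem sm1 (t : ℤ) (ht : t = 1 ∨ t = -1) : StepM t (pat t ![-1,1,1,1,1,1,1,1,1]) 1 := by
  intro kd pr h1 h2 i
  rcases ht with rfl | rfl <;> fin_cases i <;> simp [gm, pat] <;> omega
theorem sm2 (t : ℤ) (ht : t = 1 ∨ t = -1) : StepM t (pat t ![-1,-1,1,1,1,1,1,1,1]) 2 := by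
  intro kd pr h1 h2 i
  rcases ht with rfl | rfl <;> fin_cases i <;> simp [gm, pat] <;> omega
theorem cm2 (t : ℤ) (ht : t = 1 ∨ t = -1) : CallM t (pat t ![-1,-1,-1,1,1,1,1,1,1]) := by
  intro kd pr h1 h2 i
  rcases ht with rfl | rfl <;> fin_cases i <;> simp [gm, pat] <;> omega
theorem sm3 (t : ℤ) (ht : t = 1 ∨ t = -1) : StepM t (pat t ![-1,-1,-1,1,1,1,1,1,1]) 3 := by
  intro kd pr h1 h2 i
  rcases ht with rfl | rfl <;> fin_cases i <;> simp [gm, pat] <;> omega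
theorem sm4 (t : ℤ) (ht : t = 1 ∨ t = -1) : StepM t (pat t ![-1,-1,-1,-1,1,1,1,1,1]) 4 := by
  intro kd pr h1 h2 i
  rcases ht with rfl | rfl <;> fin_cases i <;> simp [gm, pat] <;> omega
theorem sm5 (t : ℤ) (ht : t = 1 ∨ t = -1) : StepM t (pat t ![-1,-1,-1,-1,-1,1,1,1,1]) 0 := by
  intro kd pr h1 h2 i
  rcases ht with rfl | rfl <;> fin_cases i <;> simp [gm, pat] <;> omega
theorem sm6 (t : ℤ) (ht : t = 1 ∨ t = -1) : StepM t (pat t ![1,-1,-1,-1,-1,1,1,1,1]) 1 := by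
  intro kd pr h1 h2 i
  rcases ht with rfl | rfl <;> fin_cases i <;> simp [gm, pat] <;> omega
theorem sm7 (t : ℤ) (ht : t = 1 ∨ t = -1) : StepM t (pat t ![1,1,-1,-1,-1,1,1,1,1]) 2 := by
  intro kd pr h1 h2 i
  rcases ht with rfl | rfl <;> fin_cases i <;> simp [gm, pat] <;> omega
theorem cm7 (t : ℤ) (ht : t = 1 ∨ t = -1) : CallM t (pat t ![1,1,1,-1,-1,1,1,1,1]) := by
  intro kd pr h1 h2 i
  rcases ht with rfl | rfl <;> fin_cases i <;> simp [gm, pat] <;> omega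
theorem sm8 (t : ℤ) (ht : t = 1 ∨ t = -1) : StepM t (pat t ![1,1,1,-1,-1,1,1,1,1]) 5 := by
  intro kd pr h1 h2 i
  rcases ht with rfl | rfl <;> fin_cases i <;> simp [gm, pat] <;> omega
theorem sm9 (t : ℤ) (ht : t = 1 ∨ t = -1) : StepM t (pat t ![1,1,1,-1,-1,-1,1,1,1]) 6 := by
  intro kd pr h1 h2 i
  rcases ht with rfl | rfl <;> fin_cases i <;> simp [gm, pat] <;> omega
theorem sm10 (t : ℤ) (ht : t = 1 ∨ t = -1) : StepM t (pat t ![1,1,1,-1,-1,-1,-1,1,1]) 0 := by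
  intro kd pr h1 h2 i
  rcases ht with rfl | rfl <;> fin_cases i <;> simp [gm, pat] <;> omega
theorem sm11 (t : ℤ) (ht : t = 1 ∨ t = -1) : StepM t (pat t ![-1,1,1,-1,-1,-1,-1,1,1]) 1 := by
  intro kd pr h1 h2 i
  rcases ht with rfl | rfl <;> fin_cases i <;> simp [gm, pat] <;> omega
theorem sm12 (t : ℤ) (ht : t = 1 ∨ t = -1) : StepM t (pat t ![-1,-1,1,-1,-1,-1,-1,1,1]) 2 := by
  intro kd pr h1 h2 i
  rcases ht with rfl | rfl <;> fin_cases i <;> simp [gm, pat] <;> omega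
theorem cm12 (t : ℤ) (ht : t = 1 ∨ t = -1) : CallM t (pat t ![-1,-1,-1,-1,-1,-1,-1,1,1]) := by
  intro kd pr h1 h2 i
  rcases ht with rfl | rfl <;> fin_cases i <;> simp [gm, pat] <;> omega
theorem sm13 (t : ℤ) (ht : t = 1 ∨ t = -1) : StepM t (pat t ![-1,-1,-1,-1,-1,-1,-1,1,1]) 7 := by
  intro kd pr h1 h2 i
  rcases ht with rfl | rfl <;> fin_cases i <;> simp [gm, pat] <;> omega
theorem sm14 (t : ℤ) (ht : t = 1 ∨ t = -1) : StepM t (pat t ![-1,-1,-1,-1,-1,-1,-1,-1,1]) 8 := by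
  intro kd pr h1 h2 i
  rcases ht with rfl | rfl <;> fin_cases i <;> simp [gm, pat] <;> omega

def st (s : St) (k : ℕ) (c : ℤ) (m : Fin 9 → ℤ) : St := fun i j =>
  if i < k then c else if i = k then m j else s i j

theorem st_lt (s : St) (k : ℕ) (c : ℤ) (m : Fin 9 → ℤ) {i : ℕ} (h : i < k) (j : Fin 9) :
    st s k c m i j = c := by simp [st, h]
theorem st_eq (s : St) (k : ℕ) (c : ℤ) (m : Fin 9 → ℤ) (j : Fin 9) :
    st s k c m k j = m j := by simp [st]
theorem st_gt (s : St) (k : ℕ) (c : ℤ) (m : Fin 9 → ℤ) {i : ℕ} (h : k < i) (j : Fin 9) :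
    st s k c m i j = s i j := by
  have h1 : ¬ i < k := by omega
  have h2 : ¬ i = k := by omega
  simp [st, h1, h2]

theorem st_bd {s : St} (hs : Bd s) (k : ℕ) {c : ℤ} (hc : c = 1 ∨ c = -1) {m : Fin 9 → ℤ}
    (hm : ∀ j, m j = 1 ∨ m j = -1) : Bd (st s k c m) := by
  intro i j
  have := hm j
  have := hs i j
  unfold st
  split_ifs <;> omega

theorem outer_stable {s : St} (hs : Bd s) (k : ℕ) {c t : ℤ} (ht : t = 1 ∨ t = -1)
    (hc : c = 1 ∨ c = -1) {m : Fin 9 → ℤ}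
    (hm : ∀ j, m j = 1 ∨ m j = -1) (hm8 : m 8 = t) (h8 : s k 8 = t)
    (hX : s (k + 1) 2 = -t) (hX1 : s (k + 1) 1 = -t)
    (hst : ∀ i, k + 1 ≤ i → ∀ j, ¬ Unst s (i, j)) (i : ℕ) (hi : k + 1 ≤ i) (j : Fin 9) :
    ¬ Unst (st s k c m) (i, j) := by
  have key := hst i hi j
  have hb := st_bd hs k hc hm
  unfold Unst g at key ⊢
  have e0 : st s k c m i = s i := by
    funext j; exact st_gt s k c m (by omega) j
  have e1 : st s k c m (i + 1) = s (i + 1) := by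
    funext j; exact st_gt s k c m (by omega) j
  have ep : par (st s k c m) i = par s i := by simp only [par, e1]
  obtain ⟨i, rfl⟩ : ∃ i', i = i' + 1 := ⟨i - 1, by omega⟩
  have ey : yy (st s k c m) (i + 1) = yy s (i + 1) := by
    simp only [yy]
    by_cases h : i = k
    · subst h; rw [st_eq, hm8, h8]
    · rw [st_gt s k c m (by omega)]
  simp only [e0, e1, ep, ey] at key ⊢
  by_cases hj : j = 2
  · subst hj
    by_cases h : i = k
    · subst h
      have h1 := hb.kid (i + 1)
      have h2 := hs (i + 1) 7
      simp only [gm, hX, hX1]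
      rcases ht with rfl | rfl <;> simp <;> omega
    · have ek : kid (st s k c m) (i + 1) = kid s (i + 1) := by
        simp only [kid]
        rw [st_gt s k c m (by omega), st_gt s k c m (by omega)]
      rw [ek]; exact key
  · have : ∀ a b : ℤ, gm (s (i + 1 + 1) 2) (yy s (i + 1)) a (par s (i + 1)) (s (i + 1)) j =
        gm (s (i + 1 + 1) 2) (yy s (i + 1)) b (par s (i + 1)) (s (i + 1)) j := by
      intro a b
      fin_cases j <;> simp [gm] at hj ⊢
    rw [this _ (kid s (i + 1))]; exact key

theorem inner_stable {s : St} (hs : Bd s) (k : ℕ) {c : ℤ} 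
    (hc : c = 1 ∨ c = -1) {m : Fin 9 → ℤ}
    (hm : ∀ j, m j = 1 ∨ m j = -1) (hm2 : m 2 = c) (i : ℕ) (hi : i < k) (j : Fin 9) :
    ¬ Unst (st s k c m) (i, j) := by
  have hb := st_bd hs k hc hm
  unfold Unst g
  have e0 : st s k c m i = fun _ => c := by
    funext j; exact st_lt s k c m hi j
  have eX : st s k c m (i + 1) 2 = c := by
    by_cases h : i + 1 = k
    · subst h; rw [st_eq, hm2]
    · rw [st_lt s k c m (by omega)]
  have ey : yy (st s k c m) i = c := by
    cases i with
    | zero => simp only [yy, e0]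
    | succ i => simp only [yy]; rw [st_lt s k c m (by omega)]
  simp only [e0, eX, ey]
  exact settled_stable c hc _ _ (hb.kid _) (hb.par _) j

theorem step_unique {s : St} (hs : Bd s) (k : ℕ) {t : ℤ} (ht : t = 1 ∨ t = -1) {m : Fin 9 → ℤ}
    (hm : ∀ j, m j = 1 ∨ m j = -1) (hm8 : m 8 = t) (h8 : s k 8 = t)
    (hX : s (k + 1) 2 = -t) (hX1 : s (k + 1) 1 = -t)
    (hst : ∀ i, k + 1 ≤ i → ∀ j, ¬ Unst s (i, j)) (j : Fin 9) (hj : StepM t m j)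
    (w : ℕ × Fin 9) : Unst (st s k (m 2) m) w ↔ w = (k, j) := by
  obtain ⟨i, l⟩ := w
  have hb := st_bd hs k (hm 2) hm
  rcases lt_trichotomy i k with h | h | h
  · have := inner_stable hs k (hm 2) hm rfl i h l
    simp only [this, Prod.mk.injEq, false_iff]; omega
  · subst h
    have := hj _ _ (hb.kid i) (hb.par i) l
    have e0 : st s i (m 2) m i = m := by funext j; exact st_eq s i _ m j
    have ey : yy (st s i (m 2) m) i = m 2 := by
      cases i with
      | zero => simp only [yy, st_eq]
      | succ i => simp only [yy]; rw [st_lt _ _ _ _ (by omega)]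
    unfold Unst g
    simp only [e0, ey]
    rw [st_gt _ _ _ _ (by omega), hX, this]
    simp
  · have := outer_stable hs k ht (hm 2) hm hm8 h8 hX hX1 hst i h l
    simp only [this, Prod.mk.injEq, false_iff]; omega

theorem flp_st (s : St) (k : ℕ) (c : ℤ) (m m' : Fin 9 → ℤ) (j : Fin 9)
    (h : ∀ l, m' l = if l = j then - m l else m l) : flp (st s k c m) (k, j) = st s k c m' := by
  funext i l
  unfold flp st
  simp only [Prod.mk.injEq, h]
  split_ifs <;> first | rfl | omega

/-- The main recursive claim. -/
def Claim (k : ℕ) : Prop := ∀ (s : St) (t : ℤ), (t = 1 ∨ t = -1) → Bd s →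
  (∀ i, i < k → ∀ j, s i j = t) → s k 2 = -t → s k 1 = -t →
  (0 < k → ∀ i, k ≤ i → ∀ j, ¬ Unst s (i, j)) →
  ∃ L, 2 * 2 ^ k ≤ L.length + 2 ∧ Run s L (fun i j => if i < k then -t else s i j)

theorem claim_zero : Claim 0 := by
  intro s t _ _ _ _ _ _
  refine ⟨[], by simp, ?_⟩
  simp only [not_lt_zero, if_false]
  exact Run.nil s

theorem claim_succ (k : ℕ) (ih : Claim k) : Claim (k + 1) := by
  intro s t ht hs hin hX hX1 hst
  replace hst := hst (by omega)
  have h8 : s k 8 = t := hin k (by omega) 8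
  have hpat : ∀ q : Fin 9 → ℤ, (∀ j, q j = 1 ∨ q j = -1) →
      ∀ j, pat t q j = 1 ∨ pat t q j = -1 := by
    intro q hq j
    unfold pat
    rcases ht with rfl | rfl <;> rcases hq j with h | h <;> simp [h]
  have hpm : ∀ (q q' : Fin 9 → ℤ) (j : Fin 9), (∀ l, q' l = if l = j then - q l else q l) →
      ∀ l, pat t q' l = if l = j then - pat t q l else pat t q l := by
    intro q q' j h l
    unfold pat
    rw [h]; split_ifs <;> ring
  have R1 : ∀ (q q' : Fin 9 → ℤ) (j : Fin 9), (∀ j, q j = 1 ∨ q j = -1) → q 8 = 1 →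
      (∀ l, q' l = if l = j then - q l else q l) → j ≠ 2 → StepM t (pat t q) j →
      Run (st s k (t * q 2) (pat t q)) [(k, j)] (st s k (t * q' 2) (pat t q')) := by
    intro q q' j hq hq8 hqq hj hS
    refine Run.cons _ _ _ _ (step_unique hs k ht (hpat q hq) (by simp [pat, hq8]) h8 hX hX1
      hst j hS) ?_
    rw [flp_st _ _ _ _ _ _ (hpm q q' j hqq), hqq 2, if_neg (Ne.symm hj)]
    exact Run.nil _
  have R2 : ∀ (q q' : Fin 9 → ℤ), (∀ j, q j = 1 ∨ q j = -1) → q 8 = 1 →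
      (∀ l, q' l = if l = 2 then - q l else q l) → q' 1 = q' 2 → StepM t (pat t q) 2 →
      CallM t (pat t q') → ∃ L : List (ℕ × Fin 9), 2 * 2 ^ k ≤ L.length + 2 ∧
      Run (st s k (t * q 2) (pat t q)) ((k, 2) :: L) (st s k (t * q' 2) (pat t q')) := by
    intro q q' hq hq8 hqq h12 hS hC
    have hq' : ∀ j, q' j = 1 ∨ q' j = -1 := by
      intro j; rw [hqq]; have := hq j; split_ifs <;> omega
    have hq2 : q 2 = - q' 2 := by rw [hqq 2]; simp
    have hc : t * q 2 = 1 ∨ t * q 2 = -1 := hpat q hq 2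
    have hm := hpat q' hq'
    have hb := st_bd hs k hc hm
    have hm8 : pat t q' 8 = t := by simp [pat, hqq 8, hq8]
    obtain ⟨L, hL, hR⟩ := ih (st s k (t * q 2) (pat t q')) (t * q 2) hc hb
      (fun i hi j => st_lt _ _ _ _ hi j) (by rw [st_eq]; simp [pat, hq2])
      (by rw [st_eq]; simp [pat, hq2, h12]) (by
        intro hk i hi j
        rcases hi.eq_or_lt with h | h
        · subst h
          have := hC _ _ (hb.kid k) (hb.par k) j
          have e0 : st s k (t * q 2) (pat t q') k = pat t q' := by
            funext j; exact st_eq s k _ _ j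
          have ey : yy (st s k (t * q 2) (pat t q')) k = - pat t q' 2 := by
            cases k with
            | zero => omega
            | succ i => simp only [yy]; rw [st_lt _ _ _ _ (by omega)]; simp [pat, hq2]
          unfold Unst g
          simp only [e0, ey]
          rw [st_gt _ _ _ _ (by omega), hX]
          exact this
        · exact outer_stable hs k ht hc hm hm8 h8 hX hX1 hst i h j)
    refine ⟨L, hL, ?_⟩
    refine Run.cons _ _ _ _ (step_unique hs k ht (hpat q hq) (by simp [pat, hq8]) h8 hX hX1
      hst 2 hS) ?_
    show Run (flp (st s k (t * q 2) (pat t q)) (k, 2)) L _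
    rw [flp_st _ _ _ _ _ _ (hpm q q' 2 hqq)]
    convert hR using 1
    funext i j
    by_cases h : i < k
    · simp [h, st_lt _ _ _ _ h, hq2]
    · simp [h, st]
  have h0 := R1 ![1,1,1,1,1,1,1,1,1] ![-1,1,1,1,1,1,1,1,1] 0 (by decide) (by decide) (by decide) (by decide) (sm0 t ht)
  have h1 := R1 ![-1,1,1,1,1,1,1,1,1] ![-1,-1,1,1,1,1,1,1,1] 1 (by decide) (by decide) (by decide) (by decide) (sm1 t ht)
  obtain ⟨L2, hl2, h2⟩ := R2 ![-1,-1,1,1,1,1,1,1,1] ![-1,-1,-1,1,1,1,1,1,1] (by decide) (by decide) (by decide) (by decide) (sm2 t ht) (cm2 t ht)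
  have h3 := R1 ![-1,-1,-1,1,1,1,1,1,1] ![-1,-1,-1,-1,1,1,1,1,1] 3 (by decide) (by decide) (by decide) (by decide) (sm3 t ht)
  have h4 := R1 ![-1,-1,-1,-1,1,1,1,1,1] ![-1,-1,-1,-1,-1,1,1,1,1] 4 (by decide) (by decide) (by decide) (by decide) (sm4 t ht)
  have h5 := R1 ![-1,-1,-1,-1,-1,1,1,1,1] ![1,-1,-1,-1,-1,1,1,1,1] 0 (by decide) (by decide) (by decide) (by decide) (sm5 t ht)
  have h6 := R1 ![1,-1,-1,-1,-1,1,1,1,1] ![1,1,-1,-1,-1,1,1,1,1] 1 (by decide) (by decide) (by decide) (by decide) (sm6 t ht)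
  obtain ⟨L7, hl7, h7⟩ := R2 ![1,1,-1,-1,-1,1,1,1,1] ![1,1,1,-1,-1,1,1,1,1] (by decide) (by decide) (by decide) (by decide) (sm7 t ht) (cm7 t ht)
  have h8 := R1 ![1,1,1,-1,-1,1,1,1,1] ![1,1,1,-1,-1,-1,1,1,1] 5 (by decide) (by decide) (by decide) (by decide) (sm8 t ht)
  have h9 := R1 ![1,1,1,-1,-1,-1,1,1,1] ![1,1,1,-1,-1,-1,-1,1,1] 6 (by decide) (by decide) (by decide) (by decide) (sm9 t ht)
  have h10 := R1 ![1,1,1,-1,-1,-1,-1,1,1] ![-1,1,1,-1,-1,-1,-1,1,1] 0 (by decide) (by decide) (by decide) (by decide) (sm10 t ht)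
  have h11 := R1 ![-1,1,1,-1,-1,-1,-1,1,1] ![-1,-1,1,-1,-1,-1,-1,1,1] 1 (by decide) (by decide) (by decide) (by decide) (sm11 t ht)
  obtain ⟨L12, hl12, h12⟩ := R2 ![-1,-1,1,-1,-1,-1,-1,1,1] ![-1,-1,-1,-1,-1,-1,-1,1,1] (by decide) (by decide) (by decide) (by decide) (sm12 t ht) (cm12 t ht)
  have h13 := R1 ![-1,-1,-1,-1,-1,-1,-1,1,1] ![-1,-1,-1,-1,-1,-1,-1,-1,1] 7 (by decide) (by decide) (by decide) (by decide) (sm13 t ht)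
  have h14 := R1 ![-1,-1,-1,-1,-1,-1,-1,-1,1] ![-1,-1,-1,-1,-1,-1,-1,-1,-1] 8 (by decide) (by decide) (by decide) (by decide) (sm14 t ht)
  have hrun := (h0.append (h1.append (h2.append (h3.append (h4.append (h5.append (h6.append (h7.append (h8.append (h9.append (h10.append (h11.append (h12.append (h13.append h14))))))))))))))
  have es : st s k (t * (![1,1,1,1,1,1,1,1,1] : Fin 9 → ℤ) 2) (pat t ![1,1,1,1,1,1,1,1,1]) = s := by
    funext i j
    have e : (![1,1,1,1,1,1,1,1,1] : Fin 9 → ℤ) = fun _ => 1 := by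
      funext j; fin_cases j <;> rfl
    unfold st pat
    rw [e]
    split_ifs with h1 h2
    · rw [hin i (by omega)]; simp
    · rw [hin i (by omega)]; simp
    · rfl
  have ee : st s k (t * (![-1,-1,-1,-1,-1,-1,-1,-1,-1] : Fin 9 → ℤ) 2)
      (pat t ![-1,-1,-1,-1,-1,-1,-1,-1,-1]) = fun i j => if i < k + 1 then -t else s i j := by
    funext i j
    have e : (![-1,-1,-1,-1,-1,-1,-1,-1,-1] : Fin 9 → ℤ) = fun _ => -1 := by
      funext j; fin_cases j <;> rfl
    unfold st pat
    rw [e]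
    split_ifs <;> first | omega | simp
  rw [es, ee] at hrun
  refine ⟨_, ?_, hrun⟩
  simp only [List.length_append, List.length_cons, List.length_nil, pow_succ]
  omega

theorem claim_all (k : ℕ) : Claim k := by
  induction k with
  | zero => exact claim_zero
  | succ k ih => exact claim_succ k ih


def matM : Fin 9 → Fin 9 → ℤ :=
  ![![0, 6, 0, 0, -7, 0, 7, 0, 0],
    ![6, 0, 3, 1, 0, -1, 0, 0, 0],
    ![0, 3, 0, 0, 0, 0, 0, 1, 0],
    ![0, 1, 0, 0, 18, 0, 0, 0, 0],
    ![-7, 0, 0, 18, 0, 10, 0, 0, 0],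
    ![0, -1, 0, 0, 10, 0, 11, 0, 0],
    ![7, 0, 0, 0, 0, 11, 0, 3, 0],
    ![0, 0, 1, 0, 0, 0, 3, 0, 4],
    ![0, 0, 0, 0, 0, 0, 0, 4, 0]]

def matQ : Fin 9 → Fin 9 → ℤ :=
  ![![0, 0, 0, 0, 0, 0, 0, 0, 0],
    ![0, 0, 0, 0, 0, 0, 0, 0, 0],
    ![0, 0, 0, 1, 0, -1, 0, 1, 0],
    ![0, 0, 1, 0, 0, 0, 0, 0, 0],
    ![0, 0, 0, 0, 0, 0, 0, 0, 0],
    ![0, 0, -1, 0, 0, 0, 0, 0, 0],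
    ![0, 0, 0, 0, 0, 0, 0, 0, 0],
    ![0, 0, 1, 0, 0, 0, 0, 0, 0],
    ![0, 0, 0, 0, 0, 0, 0, 0, 0]]

def matB : Fin 9 → Fin 9 → ℤ :=
  ![![0, 0, 7, 0, 0, 0, 0, 0, 0],
    ![0, 0, 0, 0, 0, 0, 0, 0, 0],
    ![0, 0, 0, 0, 0, 0, 0, 0, 0],
    ![0, 0, 17, 0, 0, 0, 0, 0, 0],
    ![0, 0, 0, 0, 0, 0, 0, 0, 0],
    ![0, 0, 0, 0, 0, 0, 0, 0, 0],
    ![0, 0, 0, 0, 0, 0, 0, 0, 0],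
    ![0, 0, 0, 0, 0, 0, 0, 0, 0],
    ![0, 0, 0, 1, 0, -1, 0, 1, 0]]

def JJ (v w : ℕ × Fin 9) : ℤ :=
  if w.1 = v.1 then 24 ^ (v.1 + 1) * matM v.2 w.2 + (if v.1 = 0 then matQ v.2 w.2 else 0)
  else if w.1 = v.1 + 1 then 24 ^ (v.1 + 1) * matB v.2 w.2
  else if v.1 = w.1 + 1 then 24 ^ v.1 * matB w.2 v.2
  else 0

theorem matM_symm : ∀ i j, matM i j = matM j i := by decide
theorem matQ_symm : ∀ i j, matQ i j = matQ j i := by decide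
theorem matM_diag : ∀ i, matM i i = 0 := by decide
theorem matQ_diag : ∀ i, matQ i i = 0 := by decide

theorem JJ_symm (v w : ℕ × Fin 9) : JJ v w = JJ w v := by
  obtain ⟨i, a⟩ := v
  obtain ⟨j, b⟩ := w
  unfold JJ
  simp only
  rcases lt_trichotomy i j with h | h | h
  · by_cases h' : j = i + 1
    · subst h'
      simp only [if_true]
      split_ifs <;> first | rfl | omega
    · rw [if_neg (by omega), if_neg (by omega), if_neg (by omega), if_neg (by omega),
        if_neg (by omega), if_neg (by omega)]
  · subst h; simp [matM_symm a b, matQ_symm a b]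
  · by_cases h' : i = j + 1
    · subst h'
      simp only [if_true]
      split_ifs <;> first | rfl | omega
    · rw [if_neg (by omega), if_neg (by omega), if_neg (by omega), if_neg (by omega),
        if_neg (by omega), if_neg (by omega)]

theorem JJ_diag (v : ℕ × Fin 9) : JJ v v = 0 := by
  simp [JJ, matM_diag, matQ_diag]

def unit (k : ℕ) : Fin 9 → ℤ :=
  ![24 ^ (k + 1), 24 ^ (k + 1), 24 ^ k, 24 ^ k, 24 ^ (k + 1), 24 ^ k, 24 ^ (k + 1), 24 ^ k,
    24 ^ (k + 1)]

theorem unit_pos (k : ℕ) (j : Fin 9) : 0 < unit k j := by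
  fin_cases j <;> simp [unit]

/-- Row sums over levels. -/
theorem row_sum (s : St) (n k : ℕ) (hk : k ≤ n) (hs : ∀ i, n < i → ∀ j, s i j = 0) (j : Fin 9) :
    ∑ i : Fin (n + 1), ∑ l : Fin 9, JJ (k, j) ((i : ℕ), l) * s i l = unit k j * g s k j := by
  rw [Fin.sum_univ_eq_sum_range (fun i => ∑ l : Fin 9, JJ (k, j) (i, l) * s i l) (n + 1)]
  have hext : ∑ i ∈ range (n + 1), ∑ l : Fin 9, JJ (k, j) (i, l) * s i l =
      ∑ i ∈ range (n + 2), ∑ l : Fin 9, JJ (k, j) (i, l) * s i l := by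
    rw [Finset.sum_range_succ _ (n + 1)]
    simp [hs (n + 1) (by omega)]
  rw [hext]
  cases k with
  | zero =>
    have : ∑ i ∈ range (n + 2), ∑ l : Fin 9, JJ (0, j) (i, l) * s i l =
        ∑ i ∈ {0, 1}, ∑ l : Fin 9, JJ (0, j) (i, l) * s i l := by
      symm
      apply Finset.sum_subset
      · intro x hx
        simp only [mem_insert, mem_singleton, mem_range] at hx ⊢
        omega
      · intro x _ hx
        simp only [mem_insert, mem_singleton, not_or] at hx
        apply Finset.sum_eq_zero
        intro l _
        have : JJ (0, j) (x, l) = 0 := by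
          unfold JJ
          simp only
          rw [if_neg (by omega), if_neg (by omega), if_neg (by omega)]
        rw [this, zero_mul]
    rw [this, Finset.sum_pair (by omega)]
    simp only [Fin.sum_univ_succ, Fin.sum_univ_zero, JJ, g, yy, kid, par]
    fin_cases j <;> simp [matM, matQ, matB, unit, gm, Fin.succ] <;> ring
  | succ k =>
    have : ∑ i ∈ range (n + 2), ∑ l : Fin 9, JJ (k + 1, j) (i, l) * s i l =
        ∑ i ∈ {k, k + 1, k + 2}, ∑ l : Fin 9, JJ (k + 1, j) (i, l) * s i l := by
      symm
      apply Finset.sum_subset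
      · intro x hx
        simp only [mem_insert, mem_singleton, mem_range] at hx ⊢
        omega
      · intro x _ hx
        simp only [mem_insert, mem_singleton, not_or] at hx
        apply Finset.sum_eq_zero
        intro l _
        have : JJ (k + 1, j) (x, l) = 0 := by
          unfold JJ
          simp only
          rw [if_neg (by omega), if_neg (by omega), if_neg (by omega)]
        rw [this, zero_mul]
    rw [this, Finset.sum_insert (by simp), Finset.sum_pair (by omega)]
    have hk2 : ¬ k = k + 1 + 1 := by omega
    simp only [Fin.sum_univ_succ, Fin.sum_univ_zero, JJ, g, yy, kid, par]
    fin_cases j <;> simp [matM, matB, unit, gm, Fin.succ, hk2] <;> ring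

def nb (k : ℕ) : Fin 9 → Finset (ℕ × Fin 9) :=
  ![{(k + 1, 2), (k, 4), (k, 6), (k, 1)},
    {(k, 0), (k, 2), (k, 3), (k, 5)},
    if k = 0 then {(k, 1), (k, 7), (k, 3), (k, 5)} else {(k, 1), (k, 7), (k - 1, 0), (k - 1, 3)},
    {(k + 1, 2), (k, 1), (k, 4), if k = 0 then (k, 2) else (k - 1, 8)},
    {(k, 3), (k, 0), (k, 5)},
    {(k, 4), (k, 1), (k, 6), if k = 0 then (k, 2) else (k - 1, 8)},
    {(k, 5), (k, 0), (k, 7)},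
    {(k, 6), (k, 2), (k, 8), if k = 0 then (k, 2) else (k - 1, 8)},
    {(k, 7), (k + 1, 3), (k + 1, 5), (k + 1, 7)}]

theorem nb_card (k : ℕ) (j : Fin 9) : (nb k j).card ≤ 4 := by
  fin_cases j <;> simp only [nb] <;>
    first
    | exact Finset.card_le_four
    | exact Finset.card_le_three.trans (by omega)
    | (show (if k = 0 then _ else _ : Finset (ℕ × Fin 9)).card ≤ 4
       split_ifs <;> exact Finset.card_le_four)

def nM : Fin 9 → Finset (Fin 9) :=
  ![{4, 6, 1}, {0, 2, 3, 5}, {1, 7}, {1, 4}, {3, 0, 5}, {4, 1, 6}, {5, 0, 7}, {6, 2, 8}, {7}]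

def nQ : Fin 9 → Finset (Fin 9) := ![∅, ∅, {3, 5, 7}, {2}, ∅, {2}, ∅, {2}, ∅]

theorem matM_ne : ∀ j l, matM j l ≠ 0 → l ∈ nM j := by decide
theorem matQ_ne : ∀ j l, matQ j l ≠ 0 → l ∈ nQ j := by decide
theorem matB_ne : ∀ j l, matB j l ≠ 0 → (j = 0 ∧ l = 2) ∨ (j = 3 ∧ l = 2) ∨ (j = 8 ∧ l = 3) ∨
    (j = 8 ∧ l = 5) ∨ (j = 8 ∧ l = 7) := by decide

theorem nM_nb (k : ℕ) (j l : Fin 9) (h : l ∈ nM j) : (k, l) ∈ nb k j := by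
  by_cases hk : k = 0 <;> fin_cases j <;> simp [nM] at h <;> simp [nb, hk] <;> tauto

theorem nQ_nb (j l : Fin 9) (h : l ∈ nQ j) : (0, l) ∈ nb 0 j := by
  fin_cases j <;> simp [nQ] at h <;> simp [nb] <;> tauto

theorem JJ_nb (k : ℕ) (j : Fin 9) (w : ℕ × Fin 9) (h : JJ (k, j) w ≠ 0) : w ∈ nb k j := by
  obtain ⟨i, l⟩ := w
  unfold JJ at h
  simp only at h
  by_cases h1 : i = k
  · subst h1
    by_cases hM : matM j l = 0
    · simp only [if_true, hM, mul_zero, zero_add, ne_eq, ite_eq_right_iff, Classical.not_imp] at h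
      obtain ⟨rfl, h⟩ := h
      exact nQ_nb j l (matQ_ne j l h)
    · exact nM_nb i j l (matM_ne j l hM)
  · rw [if_neg h1] at h
    by_cases h2 : i = k + 1
    · subst h2
      rw [if_pos rfl] at h
      rcases matB_ne _ _ (right_ne_zero_of_mul h) with h | h | h | h | h <;>
        obtain ⟨rfl, rfl⟩ := h <;> simp [nb]
    · rw [if_neg h2] at h
      by_cases h3 : k = i + 1
      · subst h3
        rw [if_pos rfl] at h
        rcases matB_ne _ _ (right_ne_zero_of_mul h) with h | h | h | h | h <;>
          obtain ⟨rfl, rfl⟩ := h <;> simp [nb]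
      · rw [if_neg h3] at h
        exact absurd rfl h

/-- Numbering of the vertices. -/
def ev (n : ℕ) (i : Fin ((n + 1) * 9)) : ℕ × Fin 9 :=
  ((finProdFinEquiv.symm i).1, (finProdFinEquiv.symm i).2)

theorem ev_inj (n : ℕ) : Function.Injective (ev n) := by
  intro i j h
  unfold ev at h
  simp only [Prod.mk.injEq] at h
  apply finProdFinEquiv.symm.injective
  exact Prod.ext (Fin.ext h.1) h.2

theorem ev_surj (n k : ℕ) (j : Fin 9) (hk : k ≤ n) : ∃ i, ev n i = (k, j) :=
  ⟨finProdFinEquiv (⟨k, by omega⟩, j), by simp [ev]⟩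

theorem ev_le (n : ℕ) (i : Fin ((n + 1) * 9)) : (ev n i).1 ≤ n := by
  unfold ev; simp only; omega

def GG (n : ℕ) : SimpleGraph (Fin ((n + 1) * 9)) where
  Adj u w := JJ (ev n u) (ev n w) ≠ 0
  symm := ⟨fun u w h => by rw [JJ_symm]; exact h⟩
  loopless := ⟨fun u h => h (JJ_diag _)⟩

noncomputable def XX (n : ℕ) : Sym2 (Fin ((n + 1) * 9)) → ℝ :=
  Sym2.lift ⟨fun u w => -(JJ (ev n u) (ev n w) : ℝ), fun u w => by simp only [JJ_symm (ev n u) (ev n w)]⟩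

def sg (n : ℕ) (s : St) : Fin ((n + 1) * 9) → ℝ := fun i => (s (ev n i).1 (ev n i).2 : ℝ)

theorem GG_deg (n : ℕ) (v : Fin ((n + 1) * 9)) : deg (GG n) v ≤ 4 := by
  unfold deg
  refine le_trans ?_ (nb_card (ev n v).1 (ev n v).2)
  apply Finset.card_le_card_of_injOn (ev n)
  · intro u hu
    exact JJ_nb _ _ _ (Finset.mem_filter.1 hu).2
  · exact (ev_inj n).injOn

theorem impr_GG (n : ℕ) (s : St) (hs : ∀ i, n < i → ∀ j, s i j = 0) (v : Fin ((n + 1) * 9)) :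
    impr (GG n) (XX n) (sg n s) {v} =
      -((unit (ev n v).1 (ev n v).2 * (g s (ev n v).1 (ev n v).2 * s (ev n v).1 (ev n v).2) : ℤ) : ℝ) := by
  rw [impr_single, ← mul_assoc, ← row_sum s n (ev n v).1 (ev_le n v) hs (ev n v).2]
  rw [← Fintype.sum_prod_type'
    (fun (i : Fin (n + 1)) (l : Fin 9) => JJ ((ev n v).1, (ev n v).2) ((i : ℕ), l) * s i l)]
  rw [← Equiv.sum_comp (finProdFinEquiv (m := n + 1) (n := 9)).symm]
  push_cast
  rw [Finset.sum_mul, ← Finset.sum_neg_distrib]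
  apply Finset.sum_congr rfl
  intro u _
  have : (if (GG n).Adj v u then sg n s v * sg n s u * XX n s(v, u) else 0) =
      sg n s v * sg n s u * XX n s(v, u) := by
    split_ifs with h
    · rfl
    · have h0 : JJ (ev n v) (ev n u) = 0 := by
        by_contra h'; exact h h'
      simp [XX, h0]
  rw [this]
  simp only [XX, Sym2.lift_mk, sg, ev]
  ring

theorem impr_pos_iff (n : ℕ) (s : St) (hs : ∀ i, n < i → ∀ j, s i j = 0)
    (v : Fin ((n + 1) * 9)) :
    0 < impr (GG n) (XX n) (sg n s) {v} ↔ Unst s (ev n v) := by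
  rw [impr_GG n s hs, neg_pos, Unst]
  have := unit_pos (ev n v).1 (ev n v).2
  rw [Int.cast_lt_zero]
  constructor
  · intro h; by_contra h'; push Not at h'
    have := mul_nonneg this.le h'; omega
  · intro h; exact mul_neg_of_pos_of_neg this h

theorem flip_sg (n : ℕ) (s : St) (v : Fin ((n + 1) * 9)) :
    flip (sg n s) {v} = sg n (flp s (ev n v)) := by
  funext u
  simp only [flip, sg, flp, mem_singleton]
  by_cases h : u = v
  · subst h; simp
  · have : ¬ ((ev n u).1, (ev n u).2) = ev n v := fun h' => h (ev_inj n h')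
    simp [h, this]

theorem transfer (n : ℕ) {s s' : St} {L : List (ℕ × Fin 9)} (hr : Run s L s')
    (hs : ∀ i, n < i → ∀ j, s i j = 0) (hend : ∀ w, ¬ Unst s' w) :
    ∃ L' : List (Finset (Fin ((n + 1) * 9))), L'.length = L.length ∧
      ((∀ S ∈ L', S.card = 1) ∧ Improving (GG n) (XX n) (sg n s) L' ∧
        IsLocalOpt (GG n) (XX n) (applyList (sg n s) L')) ∧
      ∀ L'' : List (Finset (Fin ((n + 1) * 9))),
        ((∀ S ∈ L'', S.card = 1) ∧ Improving (GG n) (XX n) (sg n s) L'' ∧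
          IsLocalOpt (GG n) (XX n) (applyList (sg n s) L'')) → L'' = L' := by
  induction hr with
  | nil s =>
    refine ⟨[], rfl, ⟨by simp, trivial, ?_⟩, ?_⟩
    · intro v
      by_contra h
      push Not at h
      exact hend _ ((impr_pos_iff n s hs v).1 h)
    · rintro (_ | ⟨S, L''⟩) ⟨h1, h2, h3⟩
      · rfl
      · exfalso
        obtain ⟨v, rfl⟩ := Finset.card_eq_one.1 (h1 S (by simp))
        exact hend _ ((impr_pos_iff n s hs v).1 h2.1)
  | cons s w L s' h hr ih =>
    have hw : Unst s w := (h w).2 rfl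
    have hwn : w.1 ≤ n := by
      by_contra hc
      push Not at hc
      unfold Unst at hw
      rw [hs _ hc] at hw
      simp at hw
    obtain ⟨v, hv⟩ := ev_surj n w.1 w.2 hwn
    have hv : ev n v = w := hv
    have hs' : ∀ i, n < i → ∀ j, flp s w i j = 0 := by
      intro i hi j
      simp [flp, hs i hi j]
    obtain ⟨L', hl, ⟨h1, h2, h3⟩, hu⟩ := ih hs' hend
    have hf : flip (sg n s) {v} = sg n (flp s w) := by rw [flip_sg, hv]
    refine ⟨{v} :: L', by simp [hl], ⟨?_, ⟨?_, ?_⟩, ?_⟩, ?_⟩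
    · intro S hS
      rcases List.mem_cons.1 hS with rfl | hS
      · simp
      · exact h1 S hS
    · rw [impr_pos_iff n s hs, hv]; exact hw
    · rw [hf]; exact h2
    · show IsLocalOpt _ _ (applyList (flip (sg n s) {v}) L')
      rw [hf]; exact h3
    · rintro (_ | ⟨S, L''⟩) ⟨k1, k2, k3⟩
      · exfalso
        have := k3 v
        have h' : 0 < impr (GG n) (XX n) (sg n s) {v} := by
          rw [impr_pos_iff n s hs, hv]; exact hw
        exact absurd this (not_le.2 h')
      · obtain ⟨u, rfl⟩ := Finset.card_eq_one.1 (k1 S (by simp))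
        have hu1 := (h _).1 ((impr_pos_iff n s hs u).1 k2.1)
        have huv : u = v := ev_inj n (hu1.trans hv.symm)
        subst huv
        have k2' := k2.2
        have k3' : IsLocalOpt (GG n) (XX n) (applyList (flip (sg n s) {u}) L'') := k3
        rw [hf] at k2' k3'
        rw [hu L'' ⟨fun S hS => k1 S (by simp [hS]), k2', k3'⟩]

/-- The initial state. -/
def ini (n : ℕ) (c : ℤ) : St := fun i _ => if i < n then c else if i = n then -1 else 0

theorem ini_bd (n : ℕ) (c : ℤ) (hc : c = 1 ∨ c = -1) : Bd (ini n c) := by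
  intro i j; unfold ini; split_ifs <;> omega

theorem ini_top (n : ℕ) (c : ℤ) (hc : c = 1 ∨ c = -1) (hn : 0 < n) (i : ℕ) (hi : n ≤ i)
    (j : Fin 9) : ¬ Unst (ini n c) (i, j) := by
  have hb := ini_bd n c hc
  rcases hi.eq_or_lt with h | h
  · subst h
    have e0 : ini n c n = fun _ => -1 := by funext j; simp [ini]
    have e1 : ini n c (n + 1) = fun _ => 0 := by funext j; simp [ini]
    have h1 := hb.kid n
    have h2 := hb.par n
    have hy : yy (ini n c) n = c := by
      cases n with
      | zero => omega
      | succ n => simp [yy, ini]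
    unfold Unst g
    simp only [e0, e1, hy]
    rcases hc with rfl | rfl <;> fin_cases j <;> simp [gm] <;> omega
  · have : ini n c i j = 0 := by
      unfold ini; rw [if_neg (by omega), if_neg (by omega)]
    unfold Unst
    simp [this]

theorem ini_end (n : ℕ) (hn : 0 < n) (w : ℕ × Fin 9) : ¬ Unst (ini n (-1)) w := by
  obtain ⟨i, j⟩ := w
  by_cases h : n ≤ i
  · exact ini_top n (-1) (Or.inr rfl) hn i h j
  · push Not at h
    have hb := ini_bd n (-1) (Or.inr rfl)
    have e0 : ini n (-1) i = fun _ => -1 := by funext j; simp [ini, h]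
    have e1 : ini n (-1) (i + 1) 2 = -1 := by
      unfold ini; split_ifs <;> first | rfl | omega
    have hy : yy (ini n (-1)) i = -1 := by
      cases i with
      | zero => simp only [yy, e0]
      | succ i => simp only [yy, ini]; rw [if_pos (by omega)]
    unfold Unst g
    simp only [e0, e1, hy]
    exact settled_stable (-1) (Or.inr rfl) _ _ (hb.kid _) (hb.par _) j

/-- For every `n ≥ 1` there is a weighted graph with at most `C * n` vertices
(for an absolute constant `C`) and maximum degree at most 4, and a cut `σ₀`, such that there is
exactly one improving 1-flip sequence from `σ₀` ending in a local optimum, and it has length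
at least `2 ^ n`. -/
theorem flip_unique_exponential_runtime :
    ∃ C : ℕ, ∀ n : ℕ, 0 < n →
      ∃ (N : ℕ) (G : SimpleGraph (Fin N)) (X : Sym2 (Fin N) → ℝ) (σ₀ : Fin N → ℝ),
        N ≤ C * n ∧
        (∀ v, deg G v ≤ 4) ∧
        IsCut σ₀ ∧
        ∃ L : List (Finset (Fin N)),
          ((∀ S ∈ L, S.card = 1) ∧ Improving G X σ₀ L ∧ IsLocalOpt G X (applyList σ₀ L)) ∧
          (∀ L' : List (Finset (Fin N)),
            ((∀ S ∈ L', S.card = 1) ∧ Improving G X σ₀ L' ∧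
              IsLocalOpt G X (applyList σ₀ L')) → L' = L) ∧
          2 ^ n ≤ L.length := by
  refine ⟨18, fun n hn => ⟨(n + 1) * 9, GG n, XX n, sg n (ini n 1), by omega, GG_deg n, ?_, ?_⟩⟩
  · intro v
    have := ev_le n v
    unfold sg ini
    split_ifs
    · left; simp
    · right; simp
    · omega
  · obtain ⟨L, hL, hR⟩ := claim_all n (ini n 1) 1 (Or.inl rfl) (ini_bd n 1 (Or.inl rfl))
      (fun i hi j => by simp [ini, hi]) (by simp [ini]) (by simp [ini])
      (fun _ i hi j => ini_top n 1 (Or.inl rfl) hn i hi j)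
    have e : (fun i j => if i < n then (-1 : ℤ) else ini n 1 i j) = ini n (-1) := by
      funext i j
      unfold ini
      split_ifs <;> rfl
    rw [e] at hR
    obtain ⟨L', hl, h1, h2⟩ := transfer n hR (fun i hi j => by
      unfold ini; rw [if_neg (by omega), if_neg (by omega)]) (ini_end n hn)
    refine ⟨L', h1, h2, ?_⟩
    rw [hl]
    have : 2 ≤ 2 ^ n := by
      calc 2 = 2 ^ 1 := rfl
        _ ≤ 2 ^ n := Nat.pow_le_pow_right (by omega) hn
    omega

end MaxCut
end

section
/- For every natural number n there exist a finite weighted graph G = (V, E, X) with exactly 8n + 4 vertices, exactly 13n + 3 edges, and maximum degree at most 4, a cut σ₀ of G, and an improving 1-flip sequence L from σ₀ of length at least 3^n such that the cut σ₀^L obtained after performing all moves of L is a local optimum. -/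
open Finset
open scoped Classical

namespace MaxCut

variable {V : Type*} [Fintype V]

section helpers

def fl {V : Type*} [DecidableEq V] (σ : V → ℝ) (v : V) : V → ℝ :=
  fun u => if u = v then -σ u else σ u

def Imp {V : Type*} [Fintype V] [DecidableEq V] (W : V → V → ℝ) (δ : ℝ) :
    (V → ℝ) → List V → Prop
  | _, [] => True
  | σ, v :: L => δ ≤ σ v * ∑ u, W v u * σ u ∧ Imp W δ (fl σ v) L

def Good (n : ℕ) : Prop :=
  ∃ (V : Type) (_ : Fintype V) (_ : DecidableEq V) (A : V → V → Bool) (W : V → V → ℝ)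
    (σ : V → ℝ) (L : List V) (z : V) (δ : ℝ),
    Fintype.card V = 8 * n + 4 ∧
    (∀ u v, A u v = A v u) ∧ (∀ u, A u u = false) ∧
    (∀ u v, W u v = W v u) ∧ (∀ u v, A u v = false → W u v = 0) ∧
    (∑ v, ∑ u, (A v u).toNat = 2 * (13 * n + 3)) ∧
    (∀ v, ∑ u, (A v u).toNat ≤ 4) ∧ (∑ u, (A z u).toNat ≤ 1) ∧
    (∀ v, σ v = 1 ∨ σ v = -1) ∧ 0 < δ ∧ Imp W δ σ L ∧ 3 ^ n ≤ L.countP (fun v => decide (v = z))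

lemma good_zero : Good 0 := by
  refine ⟨Fin 4, inferInstance, inferInstance,
    fun i j => decide (i.val + 1 = j.val ∨ j.val + 1 = i.val),
    fun i j => if (i = 0 ∧ j = 1) ∨ (i = 1 ∧ j = 0) then 1 else 0,
    fun _ => 1, [0], 0, 1, by simp, by decide, by decide, ?_, ?_, by decide, by decide, by decide,
    by simp, by norm_num, ?_, by simp⟩
  · intro u v
    fin_cases u <;> fin_cases v <;> simp
  · intro u v
    fin_cases u <;> fin_cases v <;> simp
  · simp [Imp]

/-- inner couplings of the gadget: 0,1 delay vertices, 2 counter, 3 output, 4-7 padding -/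
def M : Fin 8 → Fin 8 → ℤ :=
  ![![0, -4, 2, 0, 0, 0, 0, 0], ![-4, 0, -2, 0, 0, 0, 0, 0], ![2, -2, 0, -1, 0, 0, 0, 0],
    ![0, 0, -1, 0, 0, 0, 0, 0], ![0, 0, 0, 0, 0, 0, 0, 0], ![0, 0, 0, 0, 0, 0, 0, 0],
    ![0, 0, 0, 0, 0, 0, 0, 0], ![0, 0, 0, 0, 0, 0, 0, 0]]

def C : Fin 8 → ℤ := ![-8, 0, -2, 0, 0, 0, 0, 0]

def B : Fin 8 → Fin 8 → Bool := fun i j =>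
  decide (M i j ≠ 0) || (decide (4 ≤ i) && decide (4 ≤ j) && decide (i ≠ j)) ||
    (decide (i = 1) && decide (j = 4)) || (decide (i = 4) && decide (j = 1))

def A' {V : Type} [DecidableEq V] (A : V → V → Bool) (z : V) : V ⊕ Fin 8 → V ⊕ Fin 8 → Bool
  | .inl u, .inl v => A u v
  | .inl u, .inr j => decide (u = z) && decide (C j ≠ 0)
  | .inr j, .inl u => decide (u = z) && decide (C j ≠ 0)
  | .inr i, .inr j => B i j

noncomputable def W' {V : Type} [DecidableEq V] (W : V → V → ℝ) (z : V) (ε : ℝ) :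
    V ⊕ Fin 8 → V ⊕ Fin 8 → ℝ
  | .inl u, .inl v => W u v
  | .inl u, .inr j => if u = z then ε * C j else 0
  | .inr j, .inl u => if u = z then ε * C j else 0
  | .inr i, .inr j => ε * M i j

def bl {V : Type} [DecidableEq V] (z v : V) : List (V ⊕ Fin 8) :=
  if v = z then [.inl v, .inr 2, .inr 3, .inr 0, .inr 2, .inr 3, .inr 1, .inr 2, .inr 3]
  else [.inl v]

lemma fl_inl {V : Type} [DecidableEq V] (σ : V → ℝ) (τ : Fin 8 → ℝ) (v : V) :
    fl (Sum.elim σ τ) (.inl v) = Sum.elim (fl σ v) τ := by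
  funext u
  rcases u with u | u <;> simp [fl]

lemma fl_inr {V : Type} [DecidableEq V] (σ : V → ℝ) (τ : Fin 8 → ℝ) (v : Fin 8) :
    fl (Sum.elim σ τ) (.inr v) = Sum.elim σ (fl τ v) := by
  funext u
  rcases u with u | u <;> simp [fl]

lemma field_inl {V : Type} [Fintype V] [DecidableEq V] (W : V → V → ℝ) (z : V) (ε : ℝ)
    (σ : V → ℝ) (τ : Fin 8 → ℝ) (v : V) :
    ∑ u, W' W z ε (.inl v) u * Sum.elim σ τ u =
      ∑ u, W v u * σ u + if v = z then ε * (-8 * τ 0 - 2 * τ 2) else 0 := by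
  rw [Fintype.sum_sum_type]
  simp only [W', Sum.elim_inl, Sum.elim_inr]
  congr 1
  split_ifs with h
  · simp [Fin.sum_univ_eight, C]; ring
  · simp

lemma field_inr {V : Type} [Fintype V] [DecidableEq V] (W : V → V → ℝ) (z : V) (ε : ℝ)
    (σ : V → ℝ) (τ : Fin 8 → ℝ) (j : Fin 8) :
    ∑ u, W' W z ε (.inr j) u * Sum.elim σ τ u =
      ε * (C j * σ z + ∑ i, M j i * τ i) := by
  rw [Fintype.sum_sum_type]
  simp only [W', Sum.elim_inl, Sum.elim_inr]
  simp only [ite_mul, zero_mul, Finset.sum_ite_eq', Finset.mem_univ, if_true]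
  rw [mul_add, Finset.mul_sum]
  congr 1
  · ring
  · exact Finset.sum_congr rfl fun _ _ => by ring

noncomputable def tt (s : ℝ) : Fin 8 → ℝ := ![s, s, s, s, 1, 1, 1, 1]

lemma imp_step {V : Type} [Fintype V] [DecidableEq V] (W : V → V → ℝ) (z : V) (ε : ℝ)
    (hε : 0 < ε) (L : List V) : ∀ (σ : V → ℝ), (∀ v, σ v = 1 ∨ σ v = -1) →
    Imp W (20 * ε) σ L → Imp (W' W z ε) ε (Sum.elim σ (tt (σ z))) (L.flatMap (bl z)) := by
  induction L with
  | nil => intros; trivial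
  | cons v L ih =>
    intro σ hσ h
    obtain ⟨h1, h2⟩ := h
    have hσ' : ∀ u, fl σ v u = 1 ∨ fl σ v u = -1 := by
      intro u
      rcases hσ u with h | h <;> by_cases huv : u = v <;> simp [fl, huv] <;> simp_all
    have ih' := ih _ hσ' h2
    rw [List.flatMap_cons]
    by_cases hv : v = z
    · subst hv
      have hfz : fl σ v v = -σ v := by simp [fl]
      simp only [bl, if_true, List.cons_append, List.nil_append, Imp, fl_inl, fl_inr,
        field_inl, field_inr, Sum.elim_inl, Sum.elim_inr, hfz]
      rw [hfz] at ih'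
      refine ⟨?_, ?_, ?_, ?_, ?_, ?_, ?_, ?_, ?_, ?_⟩
      · rcases hσ v with h | h <;> simp [h, tt] at h1 ⊢ <;> linarith
      all_goals try
        (rcases hσ v with h | h <;> simp [h, tt, fl, C, M, Fin.sum_univ_eight] <;> nlinarith)
      convert ih' using 2
      funext j
      fin_cases j <;> simp [fl, tt]
    · have hfz : fl σ v z = σ z := by simp [fl, Ne.symm hv]
      simp only [bl, hv, if_false, List.cons_append, List.nil_append, Imp, fl_inl,
        field_inl, Sum.elim_inl]
      rw [hfz] at ih'
      exact ⟨by linarith, ih'⟩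

lemma count_step {V : Type} [DecidableEq V] (z : V) (L : List V) :
    (L.flatMap (bl z)).countP (fun v => decide (v = .inr 3)) = 3 * L.countP (fun v => decide (v = z)) := by
  induction L with
  | nil => simp
  | cons v L ih =>
    rw [List.flatMap_cons, List.countP_append, ih]
    by_cases hv : v = z
    · subst hv
      simp [bl, List.countP_cons]
      ring
    · simp [bl, hv, List.countP_cons]

lemma good_succ (n : ℕ) (h : Good n) : Good (n + 1) := by
  obtain ⟨V, _, _, A, W, σ, L, z, δ, hc, hA, hA0, hW, hWA, hs, hd, hz, hσ, hδ, hI, hL⟩ := h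
  have hinl : ∀ v, ∑ u, (A' A z (.inl v) u).toNat =
      ∑ u, (A v u).toNat + if v = z then 2 else 0 := by
    intro v
    rw [Fintype.sum_sum_type]
    simp only [A']
    congr 1
    by_cases h : v = z
    · simp only [h, decide_true, Bool.true_and, if_true]
      decide
    · simp [h]
  have hinr : ∀ j, ∑ u, (A' A z (.inr j) u).toNat = ![3, 3, 4, 1, 4, 3, 3, 3] j := by
    intro j
    rw [Fintype.sum_sum_type]
    simp only [A']
    have : ∑ u, (decide (u = z) && decide (C j ≠ 0)).toNat = (decide (C j ≠ 0)).toNat := by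
      rw [Finset.sum_eq_single z] <;> simp +contextual
    rw [this]
    clear this
    revert j
    decide
  refine ⟨V ⊕ Fin 8, inferInstance, inferInstance, A' A z, W' W z (δ / 20),
    Sum.elim σ (tt (σ z)), L.flatMap (bl z), .inr 3, δ / 20, ?_, ?_, ?_, ?_, ?_, ?_, ?_, ?_, ?_,
    by positivity, ?_, ?_⟩
  · simp [hc]; ring
  · rintro (u | u) (v | v)
    · exact hA u v
    · rfl
    · rfl
    · have : ∀ u v, B u v = B v u := by decide
      exact this u v
  · rintro (u | u)
    · exact hA0 u
    · have : ∀ u, B u u = false := by decide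
      exact this u
  · rintro (u | u) (v | v)
    · exact hW u v
    · rfl
    · rfl
    · have : ∀ u v, M u v = M v u := by decide
      simp [W', this u v]
  · have key : ∀ u v, B u v = false → M u v = 0 := by decide
    rintro (u | u) (v | v) h
    · exact hWA u v h
    · simp only [A', W'] at h ⊢
      split_ifs with h'
      · simp [h'] at h; simp [h]
      · rfl
    · simp only [A', W'] at h ⊢
      split_ifs with h'
      · simp [h'] at h; simp [h]
      · rfl
    · simp [W', key u v h]
  · rw [Fintype.sum_sum_type]
    simp only [hinl, hinr, Finset.sum_add_distrib, hs]
    simp [Fin.sum_univ_eight]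
    ring
  · rintro (u | u)
    · rw [hinl]
      split_ifs with h
      · subst h; omega
      · exact hd u
    · rw [hinr]; revert u; decide
  · rw [hinr]; decide
  · rintro (u | u)
    · exact hσ u
    · rcases hσ z with h | h <;> fin_cases u <;> simp [tt, h]
  · exact imp_step W z (δ / 20) (by positivity) L σ hσ (by convert hI using 1; ring)
  · rw [count_step, pow_succ]; omega

lemma good_all (n : ℕ) : Good n := by
  induction n with
  | zero => exact good_zero
  | succ n ih => exact good_succ n ih

lemma imp_equiv {V V₂ : Type} [Fintype V] [DecidableEq V] [Fintype V₂] [DecidableEq V₂]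
    (e : V₂ ≃ V) (W : V → V → ℝ) (δ : ℝ) (L : List V) : ∀ σ : V → ℝ, Imp W δ σ L →
    Imp (fun u v => W (e u) (e v)) δ (fun u => σ (e u)) (L.map e.symm) := by
  induction L with
  | nil => intros; trivial
  | cons v L ih =>
    rintro σ ⟨h1, h2⟩
    refine ⟨?_, ?_⟩
    · simp only [Equiv.apply_symm_apply]
      rwa [Equiv.sum_comp e (fun u => W v u * σ u)]
    · have := ih _ h2
      convert this using 1
      funext u
      simp [fl, Equiv.eq_symm_apply]

lemma impr_eq {V : Type*} [Fintype V] (G : SimpleGraph V) (X : Sym2 V → ℝ) (σ : V → ℝ) (v : V) :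
    impr G X σ {v} = ∑ u ∈ Finset.univ.filter (fun u => G.Adj v u), σ v * σ u * X s(v, u) := by
  have hsub : (Finset.univ.filter (fun u => G.Adj v u)).image (fun u => s(v, u)) ⊆
      Finset.univ.filter (fun e => e ∈ G.edgeSet) := by
    intro e he
    simp only [Finset.mem_image, Finset.mem_filter, Finset.mem_univ, true_and] at he ⊢
    obtain ⟨u, hu, rfl⟩ := he
    exact hu
  unfold impr cutValue
  rw [← mul_sub, ← Finset.sum_sub_distrib, ← Finset.sum_subset hsub, Finset.sum_image,
    Finset.mul_sum]
  · refine Finset.sum_congr rfl fun u hu => ?_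
    have hne : u ≠ v := by
      rintro rfl
      simp at hu
    simp [flip, hne]
    ring
  · intro a _ b _ hab
    exact Sym2.congr_right.1 hab
  · intro e he hne
    induction e using Sym2.ind with
    | _ a b =>
      simp only [Finset.mem_image, Finset.mem_filter, Finset.mem_univ, true_and,
        SimpleGraph.mem_edgeSet] at he hne
      have ha : a ≠ v := by
        rintro rfl
        exact hne ⟨b, he, rfl⟩
      have hb : b ≠ v := by
        rintro rfl
        exact hne ⟨a, he.symm, Sym2.eq_swap⟩
      simp [flip, ha, hb]

lemma isCut_flip {V : Type*} (σ : V → ℝ) (S : Finset V) (h : IsCut σ) : IsCut (flip σ S) := by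
  intro v
  unfold flip
  rcases h v with h | h <;> split_ifs <;> simp [h]

lemma isCut_apply {V : Type*} (L : List (Finset V)) : ∀ (σ : V → ℝ), IsCut σ →
    IsCut (applyList σ L) := by
  induction L with
  | nil => exact fun _ h => h
  | cons S L ih => exact fun σ h => ih _ (isCut_flip σ S h)

lemma apply_append {V : Type*} (L K : List (Finset V)) : ∀ (σ : V → ℝ),
    applyList σ (L ++ K) = applyList (applyList σ L) K := by
  induction L with
  | nil => exact fun _ => rfl
  | cons S L ih => exact fun σ => ih _

lemma improving_append {V : Type*} [Fintype V] (G : SimpleGraph V) (X : Sym2 V → ℝ)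
    (L K : List (Finset V)) : ∀ (σ : V → ℝ), Improving G X σ L →
    Improving G X (applyList σ L) K → Improving G X σ (L ++ K) := by
  induction L with
  | nil => exact fun _ _ h => h
  | cons S L ih => exact fun σ h1 h2 => ⟨h1.1, ih _ h1.2 h2⟩

lemma extend {V : Type*} [Fintype V] (G : SimpleGraph V) (X : Sym2 V → ℝ) (σ : V → ℝ)
    (hσ : IsCut σ) : ∃ L : List (Finset V), (∀ S ∈ L, S.card = 1) ∧ Improving G X σ L ∧
      IsLocalOpt G X (applyList σ L) := by
  have hfin : {τ : V → ℝ | ∃ L : List (Finset V), (∀ S ∈ L, S.card = 1) ∧ Improving G X σ L ∧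
      applyList σ L = τ}.Finite := by
    refine Set.Finite.subset (Set.Finite.pi' (fun _ : V => Set.toFinite ({1, -1} : Set ℝ))) ?_
    rintro τ ⟨L, -, -, rfl⟩ v
    exact isCut_apply L σ hσ v
  obtain ⟨τ, ⟨L, h1, h2, rfl⟩, hmax⟩ := Set.exists_max_image _ (cutValue G X) hfin
    ⟨σ, [], by simp, trivial, rfl⟩
  refine ⟨L, h1, h2, fun v => ?_⟩
  by_contra hv
  push Not at hv
  have hmem : ∃ K : List (Finset V), (∀ S ∈ K, S.card = 1) ∧ Improving G X σ K ∧
      applyList σ K = flip (applyList σ L) {v} := by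
    refine ⟨L ++ [{v}], ?_, ?_, ?_⟩
    · intro S hS
      rcases List.mem_append.1 hS with h | h
      · exact h1 S h
      · rw [List.mem_singleton.1 h]
        exact Finset.card_singleton v
    · exact improving_append G X L [{v}] σ h2 ⟨hv, trivial⟩
    · rw [apply_append]
      rfl
  have := hmax _ hmem
  unfold impr at hv
  linarith

lemma improving_of_imp {V : Type} [Fintype V] [DecidableEq V] (G : SimpleGraph V)
    (W : V → V → ℝ) (hW : ∀ u v, W u v = W v u) (hWA : ∀ u v, ¬ G.Adj u v → W u v = 0)
    (δ : ℝ) (hδ : 0 < δ) (L : List V) : ∀ σ : V → ℝ, Imp W δ σ L →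
    Improving G (Sym2.lift ⟨W, hW⟩) σ (L.map fun v => {v}) := by
  induction L with
  | nil => intros; trivial
  | cons v L ih =>
    rintro σ ⟨h1, h2⟩
    have hf : flip σ {v} = fl σ v := by
      funext u
      by_cases h : u = v <;> simp [flip, fl, h]
    refine ⟨?_, ?_⟩
    · rw [impr_eq, Finset.sum_filter]
      refine lt_of_lt_of_le hδ (h1.trans_eq ?_)
      rw [Finset.mul_sum]
      refine Finset.sum_congr rfl fun u _ => ?_
      split_ifs with h
      · simp; ring
      · simp [hWA _ _ h]
    · show Improving _ _ (flip σ {v}) _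
      rw [hf]
      exact ih _ h2

end helpers

/-- For every `n` there is a weighted graph with exactly `8n + 4` vertices,
exactly `13n + 3` edges and maximum degree at most 4, a cut `σ₀`, and an improving 1-flip
sequence from `σ₀` of length at least `3 ^ n` whose final cut is a local optimum. -/
theorem flip_exponential_runtime (n : ℕ) :
    ∃ (G : SimpleGraph (Fin (8 * n + 4))) (X : Sym2 (Fin (8 * n + 4)) → ℝ)
      (σ₀ : Fin (8 * n + 4) → ℝ) (L : List (Finset (Fin (8 * n + 4)))),
      (Finset.univ.filter (fun e => e ∈ G.edgeSet)).card = 13 * n + 3 ∧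
      (∀ v, deg G v ≤ 4) ∧
      IsCut σ₀ ∧
      (∀ S ∈ L, S.card = 1) ∧
      Improving G X σ₀ L ∧
      3 ^ n ≤ L.length ∧
      IsLocalOpt G X (applyList σ₀ L) := by
  obtain ⟨V, _, _, A, W, σ, L, z, δ, hc, hA, hA0, hW, hWA, hs, hd, -, hσ, hδ, hI, hL⟩ := good_all n
  have e : Fin (8 * n + 4) ≃ V := (Fintype.equivFinOfCardEq hc).symm
  let G : SimpleGraph (Fin (8 * n + 4)) :=
    { Adj := fun u v => A (e u) (e v) = true
      symm := ⟨fun u v h => by rw [hA]; exact h⟩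
      loopless := ⟨fun u h => by simp [hA0] at h⟩ }
  have hdeg : ∀ v, deg G v = ∑ u, (A (e v) u).toNat := by
    intro v
    rw [deg, Finset.card_filter, ← Equiv.sum_comp e (fun u => (A (e v) u).toNat)]
    refine Finset.sum_congr rfl fun u _ => ?_
    have hG : G.Adj v u ↔ A (e v) (e u) = true := Iff.rfl
    by_cases h : A (e v) (e u) = true
    · simp [hG, h]
    · simp [hG, h]
  have hI' := improving_of_imp G (fun u v => W (e u) (e v)) (fun u v => hW _ _)
    (fun u v h => hWA _ _ (by simpa [G] using h)) δ hδ _ _ (imp_equiv e W δ L σ hI)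
  have hcut : IsCut (fun u => σ (e u)) := fun u => hσ _
  obtain ⟨K, hK1, hK2, hK3⟩ := extend G _ _ (isCut_apply _ _ hcut)
  refine ⟨G, _, fun u => σ (e u), _, ?_, ?_, hcut, ?_, improving_append G _ _ _ _ hI' hK2, ?_, ?_⟩
  · have h := G.sum_degrees_eq_twice_card_edges
    have h2 : ∑ v, G.degree v = 2 * (13 * n + 3) := by
      rw [← hs, ← Equiv.sum_comp e]
      refine Finset.sum_congr rfl fun v _ => ?_
      rw [← hdeg, deg, ← SimpleGraph.card_neighborFinset_eq_degree]
      congr 1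
      ext u
      simp
    have h3 : 2 * G.edgeFinset.card = 2 * (13 * n + 3) := h.symm.trans h2
    have h4 : G.edgeFinset.card = 13 * n + 3 := by omega
    rw [← h4]
    congr 1
    ext e
    simp
  · intro v
    rw [hdeg]
    exact hd _
  · intro S hS
    rcases List.mem_append.1 hS with h | h
    · simp at h
      obtain ⟨a, -, rfl⟩ := h
      simp
    · exact hK1 S h
  · have := List.countP_le_length (p := fun v => decide (v = z)) (l := L)
    simp
    omega
  · rw [apply_append]
    exact hK3

end MaxCut
end

section
/- Let G = (V, E, X) be a finite weighted graph and let I ⊆ V be an independent set with |I| = k. Then for every cut σ of G, every 2-flip sequence that is improving from σ and all of whose moved vertices belong to I has length at most k² (and hence at most |V|²). -/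
open Finset
open scoped Classical

namespace MaxCut

variable {V : Type*} [Fintype V]

noncomputable def pr (σ : V → ℝ) : Sym2 V → ℝ :=
  Sym2.lift ⟨fun u w => σ u * σ w, fun u w => by ring⟩

noncomputable def gain (G : SimpleGraph V) (X : Sym2 V → ℝ) (σ : V → ℝ) (u : V) : ℝ :=
  ∑ e ∈ Finset.univ.filter (fun e => e ∈ G.edgeSet), if u ∈ e then pr σ e * X e else 0

lemma impr_eq_s3 (G : SimpleGraph V) (X : Sym2 V → ℝ) (I S : Finset V)
    (hI : ∀ u ∈ I, ∀ w ∈ I, ¬ G.Adj u w) (hS : ∀ x ∈ S, x ∈ I) (σ : V → ℝ) :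
    impr G X σ S = ∑ u ∈ S, gain G X σ u := by
  unfold impr cutValue gain
  rw [Finset.sum_comm, ← mul_sub, ← Finset.sum_sub_distrib, Finset.mul_sum]
  refine Finset.sum_congr rfl fun e he => ?_
  have he' : e ∈ G.edgeSet := by simpa using he
  clear he
  induction e using Sym2.ind with
  | _ x y =>
    have hadj : G.Adj x y := he'
    have hne : x ≠ y := hadj.ne
    have key : ∀ u ∈ S, (if u ∈ s(x, y) then pr σ s(x, y) * X s(x, y) else 0)
        = (if u = x then pr σ s(x, y) * X s(x, y) else 0)
          + (if u = y then pr σ s(x, y) * X s(x, y) else 0) := by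
      intro u _
      by_cases h1 : u = x
      · subst h1; simp [hne]
      · by_cases h2 : u = y <;> simp [h1, h2, hne.symm]
    rw [Finset.sum_congr rfl key, Finset.sum_add_distrib]
    simp only [Finset.sum_ite_eq', pr, Sym2.lift_mk, flip]
    by_cases hx : x ∈ S
    · have hy : y ∉ S := fun hy => hI x (hS x hx) y (hS y hy) hadj
      simp only [hx, hy, if_true, if_false]; ring
    · by_cases hy : y ∈ S
      · simp only [hx, hy, if_true, if_false]; ring
      · simp only [hx, hy, if_false]; ring

lemma gain_flip (G : SimpleGraph V) (X : Sym2 V → ℝ) (I S : Finset V)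
    (hI : ∀ u ∈ I, ∀ w ∈ I, ¬ G.Adj u w) (hS : ∀ x ∈ S, x ∈ I) (σ : V → ℝ)
    (u : V) (hu : u ∈ I) :
    gain G X (flip σ S) u = if u ∈ S then - gain G X σ u else gain G X σ u := by
  have h : gain G X (flip σ S) u = (if u ∈ S then (-1 : ℝ) else 1) * gain G X σ u := by
    unfold gain
    rw [Finset.mul_sum]
    refine Finset.sum_congr rfl fun e he => ?_
    have he' : e ∈ G.edgeSet := by simpa using he
    clear he
    by_cases hue : u ∈ e
    · obtain ⟨y, rfl⟩ := hue
      have hadj : G.Adj u y := he'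
      have hy : y ∉ S := fun hy => hI u hu y (hS y hy) hadj
      simp only [Sym2.mem_mk_left, if_true, pr, Sym2.lift_mk, flip, hy, if_false]
      split_ifs <;> ring
    · simp [hue]
  rw [h]; split_ifs <;> ring

noncomputable def rk (I : Finset V) (b : V → ℝ) (u : V) : ℕ := (I.filter (fun w => b w ≤ b u)).card

noncomputable def pot (G : SimpleGraph V) (X : Sym2 V → ℝ) (I : Finset V) (b : V → ℝ)
    (σ : V → ℝ) : ℤ := ∑ u ∈ I, if gain G X σ u < 0 then (rk I b u : ℤ) else 0

lemma rk_lt (I : Finset V) (b : V → ℝ) (u w : V) (hu : u ∈ I) (h : b w < b u) :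
    rk I b w < rk I b u := by
  apply Finset.card_lt_card
  refine ⟨fun x hx => ?_, fun hh => ?_⟩
  · simp only [Finset.mem_filter] at hx ⊢
    exact ⟨hx.1, hx.2.trans h.le⟩
  · have := hh (Finset.mem_filter.2 ⟨hu, le_refl (b u)⟩)
    simp only [Finset.mem_filter] at this
    linarith [this.2]

lemma rk_pos (I : Finset V) (b : V → ℝ) (u : V) (hu : u ∈ I) : 0 < rk I b u :=
  Finset.card_pos.2 ⟨u, Finset.mem_filter.2 ⟨hu, le_refl _⟩⟩

lemma pot_le (G : SimpleGraph V) (X : Sym2 V → ℝ) (I : Finset V) (b : V → ℝ)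
    (σ : V → ℝ) : pot G X I b σ ≤ (I.card : ℤ) ^ 2 := by
  unfold pot
  calc _ ≤ ∑ u ∈ I, (I.card : ℤ) := by
        refine Finset.sum_le_sum fun u _ => ?_
        have : rk I b u ≤ I.card := Finset.card_filter_le _ _
        split_ifs <;> omega
    _ = _ := by simp [sq]

lemma pot_nonneg (G : SimpleGraph V) (X : Sym2 V → ℝ) (I : Finset V) (b : V → ℝ)
    (σ : V → ℝ) : 0 ≤ pot G X I b σ := by
  unfold pot
  refine Finset.sum_nonneg fun u _ => ?_
  split_ifs <;> omega

lemma pot_step (G : SimpleGraph V) (X : Sym2 V → ℝ) (I S : Finset V)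
    (hI : ∀ u ∈ I, ∀ w ∈ I, ¬ G.Adj u w) (hS : ∀ x ∈ S, x ∈ I) (hc : S.card ≤ 2)
    (σ : V → ℝ) (b : V → ℝ) (hb : ∀ u ∈ I, |gain G X σ u| = b u)
    (h : 0 < impr G X σ S) : pot G X I b σ + 1 ≤ pot G X I b (flip σ S) := by
  rw [impr_eq_s3 G X I S hI hS] at h
  have hd : pot G X I b (flip σ S) - pot G X I b σ = ∑ u ∈ S,
      ((if 0 < gain G X σ u then (rk I b u : ℤ) else 0)
        - (if gain G X σ u < 0 then (rk I b u : ℤ) else 0)) := by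
    unfold pot
    rw [← Finset.sum_sub_distrib]
    symm
    apply Finset.sum_subset_zero_on_sdiff hS
    · intro x hx
      rw [Finset.mem_sdiff] at hx
      rw [gain_flip G X I S hI hS σ x hx.1]
      simp [hx.2]
    · intro x hx
      rw [gain_flip G X I S hI hS σ x (hS x hx)]
      simp [hx]
  suffices 0 < pot G X I b (flip σ S) - pot G X I b σ by omega
  rw [hd]
  obtain h0 | h1 | h2 : S.card = 0 ∨ S.card = 1 ∨ S.card = 2 := by omega
  · rw [Finset.card_eq_zero] at h0
    subst h0; simp at h
  · obtain ⟨u, rfl⟩ := Finset.card_eq_one.1 h1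
    have hu := hS u (by simp)
    have := rk_pos I b u hu
    simp only [Finset.sum_singleton] at h ⊢
    rw [if_pos h, if_neg h.not_gt]
    omega
  · obtain ⟨u, w, hne, rfl⟩ := Finset.card_eq_two.1 h2
    have hu := hS u (by simp)
    have hw := hS w (by simp)
    have pu := rk_pos I b u hu
    have pw := rk_pos I b w hw
    rw [Finset.sum_pair hne] at h ⊢
    have bu := hb u hu
    have bw := hb w hw
    have l1 := rk_lt I b u w hu
    have l2 := rk_lt I b w u hw
    rw [← bu, ← bw] at l1 l2
    rcases lt_trichotomy (gain G X σ u) 0 with a | a | a <;>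
    rcases lt_trichotomy (gain G X σ w) 0 with c | c | c
    all_goals first
      | (exfalso; linarith)
      | skip
    · have := l2 (by rw [abs_of_neg a, abs_of_pos c]; linarith)
      simp only [a, c, a.not_gt, c.not_gt, if_true, if_false]; omega
    · simp only [a, c, lt_irrefl, c.not_gt, if_true, if_false]; omega
    · have := l1 (by rw [abs_of_pos a, abs_of_neg c]; linarith)
      simp only [a, c, a.not_gt, c.not_gt, if_true, if_false]; omega
    · simp only [a, c, lt_irrefl, a.not_gt, if_true, if_false]; omega
    · simp only [a, c, a.not_gt, c.not_gt, if_true, if_false]; omega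

lemma main_bound (G : SimpleGraph V) (X : Sym2 V → ℝ) (I : Finset V)
    (hI : ∀ u ∈ I, ∀ w ∈ I, ¬ G.Adj u w) (b : V → ℝ) (L : List (Finset V)) :
    ∀ (σ : V → ℝ), (∀ u ∈ I, |gain G X σ u| = b u) → (∀ S ∈ L, S.card ≤ 2) →
    (∀ S ∈ L, ∀ x ∈ S, x ∈ I) → Improving G X σ L →
    (L.length : ℤ) + pot G X I b σ ≤ (I.card : ℤ) ^ 2 := by
  induction L with
  | nil => intro σ _ _ _ _; simpa using pot_le G X I b σ
  | cons S L ih =>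
    intro σ hb hs hm hi
    have hS := hm S (by simp)
    have h1 := pot_step G X I S hI hS (hs S (by simp)) σ b hb hi.1
    have h2 := ih (flip σ S) (fun u hu => by
      rw [gain_flip G X I S hI hS σ u hu, ← hb u hu]
      split_ifs <;> simp) (fun T hT => hs T (by simp [hT]))
      (fun T hT => hm T (by simp [hT])) hi.2
    push_cast [List.length_cons]
    linarith

/-- Every improving 2-flip sequence all of whose moved vertices belong to an
independent set of size `k` has length at most `k ^ 2` (and hence at most `|V| ^ 2`). -/
theorem two_flip_independent_set_quadratic {V : Type*} [Fintype V]
    (G : SimpleGraph V) (X : Sym2 V → ℝ) (I : Finset V) (k : ℕ)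
    (hI : ∀ u ∈ I, ∀ w ∈ I, ¬ G.Adj u w) (hcard : I.card = k)
    (σ : V → ℝ) (hσ : IsCut σ)
    (L : List (Finset V))
    (hsize : ∀ S ∈ L, S.card ≤ 2)
    (hmoved : ∀ S ∈ L, ∀ x ∈ S, x ∈ I)
    (himp : Improving G X σ L) :
    L.length ≤ k ^ 2 ∧ L.length ≤ Fintype.card V ^ 2 := by
  have h := main_bound G X I hI (fun u => |gain G X σ u|) L σ (fun _ _ => rfl) hsize hmoved himp
  have h0 := pot_nonneg G X I (fun u => |gain G X σ u|) σ
  have h1 : L.length ≤ I.card ^ 2 := by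
    have : (L.length : ℤ) ≤ (I.card : ℤ) ^ 2 := by linarith
    exact_mod_cast this
  refine ⟨hcard ▸ h1, h1.trans (Nat.pow_le_pow_left (Finset.card_le_univ I) 2)⟩


end MaxCut
end

section
/- Let G = (V, E, X) be a finite weighted graph, let σ be a cut of G, and let S ⊆ V be an independent set. Then the change in cut value caused by flipping all vertices of S simultaneously equals the sum of the individual single-vertex improvements: impr_σ(S) = Σ_{v ∈ S} impr_σ(v). -/
open Finset
open scoped Classical

namespace MaxCut

variable {V : Type*} [Fintype V]

theorem impr_insert_aux (G : SimpleGraph V) (X : Sym2 V → ℝ) (σ : V → ℝ)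
    (a : V) (S : Finset V) (ha : a ∉ S) (hS : ∀ w ∈ S, ¬ G.Adj a w) :
    impr G X σ (insert a S) = impr G X σ {a} + impr G X σ S := by
  unfold impr cutValue
  rw [← mul_sub, ← mul_sub, ← mul_sub, ← mul_add, ← Finset.sum_sub_distrib,
    ← Finset.sum_sub_distrib, ← Finset.sum_sub_distrib, ← Finset.sum_add_distrib]
  congr 1
  refine Finset.sum_congr rfl ?_
  intro e he
  induction e using Sym2.ind with
  | _ u w =>
    have hadj : G.Adj u w := by simpa using he
    have hne : u ≠ w := hadj.ne
    simp only [Sym2.lift_mk, flip, Finset.mem_insert, Finset.mem_singleton]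
    by_cases hu : u = a
    · subst hu
      have hw : w ∉ S := fun h => hS w h hadj
      simp [ha, hw, hne.symm]
    · by_cases hw : w = a
      · subst hw
        have hu' : u ∉ S := fun h => hS u h hadj.symm
        simp [ha, hu', hne]
      · simp [hu, hw]

/-- Flipping all vertices of an independent set `S` simultaneously changes the cut
value by the sum of the individual single-vertex improvements. -/
theorem impr_independent_set_eq_sum {V : Type*} [Fintype V]
    (G : SimpleGraph V) (X : Sym2 V → ℝ)
    (σ : V → ℝ) (hσ : IsCut σ)
    (S : Finset V) (hS : ∀ u ∈ S, ∀ w ∈ S, ¬ G.Adj u w) :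
    impr G X σ S = ∑ v ∈ S, impr G X σ {v} := by
  induction S using Finset.induction_on with
  | empty =>
    have h : flip σ ∅ = σ := by
      funext v
      simp [flip]
    simp [impr, h]
  | insert a S ha ih =>
    rw [Finset.sum_insert ha, ← ih (fun u hu w hw =>
      hS u (Finset.mem_insert_of_mem hu) w (Finset.mem_insert_of_mem hw))]
    exact impr_insert_aux G X σ a S ha (fun w hw =>
      hS a (Finset.mem_insert_self a S) w (Finset.mem_insert_of_mem hw))

end MaxCut
end

section
/- For every real number b there exists a constant c > 0 such that for all sufficiently large n the following holds: if X₁, …, Xₙ are independent random variables, each uniformly distributed on the interval [b, b+1], then with probability at least 1 − 2^{−cn} one has ε([−n/5, n/5], X₁, …, Xₙ) < 2^{−cn}; that is, with probability at least 1 − 2^{−cn}, for every real x ∈ [−n/5, n/5] there exist signs a₁, …, aₙ ∈ {−1, 1} with |x − Σ_{i=1}^n a_i X_i| < 2^{−cn}. -/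
open MeasureTheory ProbabilityTheory

/-- The uniform probability measure on the interval `[a, b]`. -/
noncomputable def uniformIcc (a b : ℝ) : Measure ℝ :=
  (volume (Set.Icc a b))⁻¹ • volume.restrict (Set.Icc a b)

/-- Law of `2 (x - w)` for `x, w` iid uniform. -/
noncomputable def diffLaw (b : ℝ) : Measure ℝ :=
  ((uniformIcc b (b + 1)).prod (uniformIcc b (b + 1))).map (fun e => 2 * (e.1 - e.2))

lemma uniformIcc_eq (b : ℝ) : uniformIcc b (b + 1) = volume.restrict (Set.Icc b (b + 1)) := by
  simp [uniformIcc]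

instance uniformIcc_prob (b : ℝ) : IsProbabilityMeasure (uniformIcc b (b + 1)) := by
  rw [uniformIcc_eq]
  exact ⟨by simp⟩

instance diffLaw_prob (b : ℝ) : IsProbabilityMeasure (diffLaw b) :=
  Measure.isProbabilityMeasure_map (by fun_prop)

lemma diffLaw_half (b : ℝ) (S : Set ℝ) (hS : MeasurableSet S) (l : ℝ)
    (hl : ∀ w ∈ Set.Icc l (l + 1/2), ∀ y ∈ S, w + y / 2 ∈ Set.Icc b (b + 1))
    (hl' : Set.Icc l (l + 1/2) ⊆ Set.Icc b (b + 1)) :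
    ENNReal.ofReal (1/4) * volume S ≤ ((uniformIcc b (b + 1)).prod (uniformIcc b (b + 1)))
      {e | 2 * (e.1 - e.2) ∈ S ∧ e.2 ∈ Set.Icc l (l + 1/2)} := by
  have hm : MeasurableSet {e : ℝ × ℝ | 2 * (e.1 - e.2) ∈ S ∧ e.2 ∈ Set.Icc l (l + 1/2)} := by
    apply MeasurableSet.inter
    · exact (show Measurable (fun e : ℝ × ℝ => 2 * (e.1 - e.2)) by fun_prop) hS
    · exact measurable_snd measurableSet_Icc
  rw [Measure.prod_apply_symm hm]
  simp only [uniformIcc_eq]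
  have key : ∀ w ∈ Set.Icc l (l + 1/2), ENNReal.ofReal (1/2) * volume S ≤
      (volume.restrict (Set.Icc b (b + 1)))
        ((fun x => (x, w)) ⁻¹' {e : ℝ × ℝ | 2 * (e.1 - e.2) ∈ S ∧ e.2 ∈ Set.Icc l (l + 1/2)}) := by
    intro w hw
    rw [Measure.restrict_apply (hm.preimage (by fun_prop))]
    have h1 : ENNReal.ofReal (1/2) * volume S = volume ((fun x => 2 * (x - w)) ⁻¹' S) := by
      have : (fun x : ℝ => 2 * (x - w)) ⁻¹' S = (fun x => x + (-w)) ⁻¹' ((fun x => 2 * x) ⁻¹' S) := rfl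
      rw [this, measure_preimage_add_right, Real.volume_preimage_mul_left (by norm_num)]
      congr 2
      norm_num [abs_of_pos]
    rw [h1]
    apply measure_mono
    intro x hx
    refine ⟨⟨hx, hw⟩, ?_⟩
    have := hl w hw _ hx
    convert this using 1
    ring
  calc ENNReal.ofReal (1/4) * volume S
      = ∫⁻ w in Set.Icc l (l + 1/2), ENNReal.ofReal (1/2) * volume S := by
        simp only [lintegral_const, Measure.restrict_apply_univ, Real.volume_Icc]
        rw [show l + 1/2 - l = 1/2 by ring, mul_assoc, mul_comm (volume S), ← mul_assoc,
          ← ENNReal.ofReal_mul (by norm_num)]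
        norm_num
    _ ≤ ∫⁻ w in Set.Icc l (l + 1/2), (volume.restrict (Set.Icc b (b + 1)))
        ((fun x => (x, w)) ⁻¹' {e : ℝ × ℝ | 2 * (e.1 - e.2) ∈ S ∧ e.2 ∈ Set.Icc l (l + 1/2)}) :=
        setLIntegral_mono' measurableSet_Icc key
    _ ≤ _ := lintegral_mono_set hl'

lemma diffLaw_ge (b : ℝ) :
    ENNReal.ofReal (1/4) • volume.restrict (Set.Icc (-1 : ℝ) 1) ≤ diffLaw b := by
  rw [Measure.le_iff]
  intro S hS
  have hf : Measurable (fun e : ℝ × ℝ => 2 * (e.1 - e.2)) := by fun_prop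
  rw [Measure.smul_apply, Measure.restrict_apply hS, diffLaw, Measure.map_apply hf hS, smul_eq_mul]
  set S1 := S ∩ Set.Icc (-1) 0
  set S2 := S ∩ Set.Ioc 0 1
  have h1 := diffLaw_half b S1 (hS.inter measurableSet_Icc) (b + 1/2) (by
    rintro w ⟨hw1, hw2⟩ y ⟨_, hy1, hy2⟩
    constructor <;> linarith) (by intro x hx; constructor <;> linarith [hx.1, hx.2])
  have h2 := diffLaw_half b S2 (hS.inter measurableSet_Ioc) b (by
    rintro w ⟨hw1, hw2⟩ y ⟨_, hy1, hy2⟩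
    constructor <;> linarith) (by intro x hx; constructor <;> linarith [hx.1, hx.2])
  have h3 : volume (S ∩ Set.Icc (-1) 1) ≤ volume S1 + volume S2 := by
    refine le_trans (measure_mono ?_) (measure_union_le _ _)
    rintro x ⟨hx, hx1, hx2⟩
    rcases le_or_gt x 0 with h | h
    · exact Or.inl ⟨hx, hx1, h⟩
    · exact Or.inr ⟨hx, h, hx2⟩
  calc _ ≤ ENNReal.ofReal (1/4) * (volume S1 + volume S2) := by gcongr
    _ ≤ _ := by
      rw [mul_add]
      refine (add_le_add h1 h2).trans ?_
      rw [← measure_union]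
      · apply measure_mono
        rintro e (⟨h, _⟩ | ⟨h, _⟩)
        · exact h.1
        · exact h.1
      · rw [Set.disjoint_left]
        rintro e ⟨h, _⟩ ⟨h', _⟩
        linarith [h.2.2, h'.2.1]
      · apply MeasurableSet.inter
        · exact hf (hS.inter measurableSet_Ioc)
        · exact measurable_snd measurableSet_Icc

/-- The unit window. -/
def win : Set ℝ := Set.Icc (-1/2) (1/2)

/-- One growth step. -/
def stepSet (A : Set ℝ) (y : ℝ) : Set ℝ := {z | z ∈ win ∧ (z ∈ A ∨ z - y ∈ A)}

lemma conv_vol (A B : Set ℝ) (hA : MeasurableSet A) (hB : MeasurableSet B)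
    (hAJ : A ⊆ win) (hBJ : B ⊆ win) :
    ∫⁻ y in Set.Icc (-1 : ℝ) 1, volume {z | z ∈ B ∧ z - y ∈ A} = volume A * volume B := by
  have hm : MeasurableSet {p : ℝ × ℝ | p.2 ∈ B ∧ p.2 - p.1 ∈ A} := by
    apply MeasurableSet.inter
    · exact measurable_snd hB
    · exact (show Measurable (fun e : ℝ × ℝ => e.2 - e.1) by fun_prop) hA
  have h1 : ∫⁻ y in Set.Icc (-1 : ℝ) 1, volume {z | z ∈ B ∧ z - y ∈ A}
      = ∫⁻ y, volume {z | z ∈ B ∧ z - y ∈ A} := by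
    apply setLIntegral_eq_of_support_subset
    intro y hy
    by_contra hcon
    apply hy
    have : {z | z ∈ B ∧ z - y ∈ A} = ∅ := by
      ext z
      simp only [Set.mem_ofPred_eq, Set.mem_empty_iff_false, iff_false]
      rintro ⟨hz, hz'⟩
      apply hcon
      have a := hBJ hz
      have a' := hAJ hz'
      simp only [win, Set.mem_Icc] at a a' ⊢
      constructor <;> linarith [a.1, a.2, a'.1, a'.2]
    simp [this]
  rw [h1]
  have h2 := Measure.prod_apply (μ := (volume : Measure ℝ)) (ν := (volume : Measure ℝ)) hm
  have h3 := Measure.prod_apply_symm (μ := (volume : Measure ℝ)) (ν := (volume : Measure ℝ)) hm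
  have h4 : ∫⁻ y, volume {z | z ∈ B ∧ z - y ∈ A} =
    ∫⁻ z, volume ((fun y => (y, z)) ⁻¹' {p : ℝ × ℝ | p.2 ∈ B ∧ p.2 - p.1 ∈ A}) := by
    rw [← h3, h2]; rfl
  rw [h4]
  have h5 : ∀ z, volume ((fun y => (y, z)) ⁻¹' {p : ℝ × ℝ | p.2 ∈ B ∧ p.2 - p.1 ∈ A})
      = B.indicator (fun _ => volume A) z := by
    intro z
    by_cases hz : z ∈ B
    · simp only [Set.preimage_ofPred_eq, hz, true_and, Set.indicator_of_mem]
      exact (Measure.measurePreserving_sub_left volume z).measure_preimage hA.nullMeasurableSet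
    · simp [hz]
  simp_rw [h5]
  rw [lintegral_indicator hB]
  simp

lemma vol_win : volume win = 1 := by
  simp [win]; norm_num

lemma meas_win : MeasurableSet win := measurableSet_Icc

lemma real_step {v g : ℝ} (hv : 0 < v) (hg : 0 ≤ g) (hgv : g ≤ v) :
    1 / (v + g) - 1 ≤ (1 / v - 1) - g / (2 * v ^ 2) := by
  have : 1 / (v + g) ≤ 1 / v - g / (2 * v ^ 2) := by
    rw [div_sub_div _ _ hv.ne' (by positivity), div_le_div_iff₀ (by positivity) (by positivity)]
    nlinarith [mul_nonneg (mul_nonneg hv.le hg) (sub_nonneg.2 hgv), mul_pos hv hv]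
  linarith

lemma step_bound (ν : Measure ℝ) [IsProbabilityMeasure ν]
    (hν : ENNReal.ofReal (1/4) • volume.restrict (Set.Icc (-1 : ℝ) 1) ≤ ν)
    (A : Set ℝ) (hA : MeasurableSet A) (hAJ : A ⊆ win) (hv : 0 < volume.real A) :
    ∫⁻ y, ENNReal.ofReal (1 / volume.real (stepSet A y) - 1) ∂ν
      ≤ ENNReal.ofReal (7/8) * ENNReal.ofReal (1 / volume.real A - 1) := by
  set v := volume.real A with hvdef
  have hAtop : volume A ≠ ⊤ := ne_top_of_le_ne_top (by simp [vol_win]) (measure_mono hAJ)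
  have hv1 : v ≤ 1 := by
    have : v ≤ volume.real win := measureReal_mono hAJ (by simp [vol_win])
    simpa [measureReal_def, vol_win] using this
  set B := win \ A with hB
  have hBm : MeasurableSet B := meas_win.diff hA
  have hBv : volume.real B = 1 - v := by
    rw [hB, measureReal_sdiff hAJ hA (by simp [vol_win])]
    simp [measureReal_def, vol_win, hvdef]
  let g : ℝ → ℝ := fun y => volume.real {z | z ∈ B ∧ z - y ∈ A}
  have hm : MeasurableSet {p : ℝ × ℝ | p.2 ∈ B ∧ p.2 - p.1 ∈ A} := by
    apply MeasurableSet.inter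
    · exact measurable_snd hBm
    · exact (show Measurable (fun e : ℝ × ℝ => e.2 - e.1) by fun_prop) hA
  have hgE : Measurable (fun y => volume {z | z ∈ B ∧ z - y ∈ A}) :=
    measurable_measure_prodMk_left hm
  have hgm : Measurable g := hgE.ennreal_toReal
  have hsec : ∀ y, MeasurableSet {z | z ∈ B ∧ z - y ∈ A} := fun y =>
    hm.preimage (show Measurable (fun z : ℝ => (y, z)) by fun_prop)
  have htr : ∀ y, volume {z | z ∈ B ∧ z - y ∈ A} ≤ volume A := by
    intro y
    calc _ ≤ volume ((fun z => z + (-y)) ⁻¹' A) := measure_mono (fun z hz => hz.2)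
      _ = _ := measure_preimage_add_right _ _ _
  have hg0 : ∀ y, 0 ≤ g y := fun y => measureReal_nonneg
  have hgv : ∀ y, g y ≤ v := fun y => ENNReal.toReal_mono hAtop (htr y)
  have hst : ∀ y, volume.real (stepSet A y) = v + g y := by
    intro y
    have : stepSet A y = A ∪ {z | z ∈ B ∧ z - y ∈ A} := by
      ext z
      simp only [stepSet, hB, Set.mem_ofPred_eq, Set.mem_union, Set.mem_sdiff]
      have := @hAJ z
      tauto
    rw [this, measureReal_union _ (hsec y) hAtop (ne_top_of_le_ne_top hAtop (htr y))]
    rw [Set.disjoint_left]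
    rintro z hz ⟨hz', _⟩
    exact hz'.2 hz
  have hgi : Integrable g ν := Integrable.of_mem_Icc 0 v hgm.aemeasurable
    (Filter.Eventually.of_forall fun y => ⟨hg0 y, hgv y⟩)
  have hint : v * (1 - v) / 4 ≤ ∫ y, g y ∂ν := by
    rw [integral_eq_lintegral_of_nonneg_ae (Filter.Eventually.of_forall hg0)
      hgm.aestronglyMeasurable]
    have e1 : ∀ y, ENNReal.ofReal (g y) = volume {z | z ∈ B ∧ z - y ∈ A} := fun y =>
      ENNReal.ofReal_toReal (ne_top_of_le_ne_top hAtop (htr y))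
    simp_rw [e1]
    rw [← ENNReal.ofReal_le_iff_le_toReal]
    · calc ENNReal.ofReal (v * (1 - v) / 4)
          = ENNReal.ofReal (1/4) * (volume A * volume B) := by
            rw [← ENNReal.ofReal_toReal hAtop, ← ENNReal.ofReal_toReal (a := volume B)
              (ne_top_of_le_ne_top (by simp [vol_win]) (measure_mono Set.sdiff_subset))]
            change _ = _ * (ENNReal.ofReal v * ENNReal.ofReal (volume.real B))
            rw [hBv, ← ENNReal.ofReal_mul hv.le, ← ENNReal.ofReal_mul (by norm_num)]
            congr 1; ring
        _ = ∫⁻ y, volume {z | z ∈ B ∧ z - y ∈ A}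
              ∂(ENNReal.ofReal (1/4) • volume.restrict (Set.Icc (-1 : ℝ) 1)) := by
            rw [lintegral_smul_measure, conv_vol A B hA hBm hAJ Set.sdiff_subset, smul_eq_mul]
        _ ≤ _ := lintegral_mono' hν le_rfl
    · refine ne_top_of_le_ne_top hAtop ?_
      calc _ ≤ ∫⁻ y, volume A ∂ν := lintegral_mono htr
        _ = _ := by simp
  have hi2 : Integrable (fun y => (1 / v - 1) - g y / (2 * v ^ 2)) ν :=
    (integrable_const _).sub (hgi.div_const _)
  have hpos : ∀ y, 0 ≤ (1 / v - 1) - g y / (2 * v ^ 2) := by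
    intro y
    have h1 := real_step hv (hg0 y) (hgv y)
    have h2 : v + g y ≤ 1 := by
      rw [← hst y]
      have : volume.real (stepSet A y) ≤ volume.real win :=
        measureReal_mono (fun z hz => hz.1) (by simp [vol_win])
      simpa [measureReal_def, vol_win] using this
    have h3 : 1 ≤ 1 / (v + g y) := by
      rw [le_div_iff₀ (by linarith [hg0 y])]; linarith
    linarith
  calc ∫⁻ y, ENNReal.ofReal (1 / volume.real (stepSet A y) - 1) ∂ν
      ≤ ∫⁻ y, ENNReal.ofReal ((1 / v - 1) - g y / (2 * v ^ 2)) ∂ν := by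
        apply lintegral_mono
        intro y
        apply ENNReal.ofReal_le_ofReal
        rw [hst y]
        exact real_step hv (hg0 y) (hgv y)
    _ = ENNReal.ofReal (∫ y, ((1 / v - 1) - g y / (2 * v ^ 2)) ∂ν) :=
        (ofReal_integral_eq_lintegral_ofReal hi2 (Filter.Eventually.of_forall hpos)).symm
    _ ≤ _ := by
        rw [← ENNReal.ofReal_mul (by norm_num)]
        apply ENNReal.ofReal_le_ofReal
        rw [integral_sub (integrable_const _) (hgi.div_const _), integral_div]
        simp only [integral_const, probReal_univ, one_smul]
        have : v * (1 - v) / 4 / (2 * v ^ 2) ≤ (∫ y, g y ∂ν) / (2 * v ^ 2) := by gcongr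
        have e : v * (1 - v) / 4 / (2 * v ^ 2) = 1/8 * (1 / v - 1) := by
          field_simp
          try ring
        linarith

/-- The set of points reached after `k` growth steps. -/
def grow (ε : ℝ) : (k : ℕ) → (Fin k → ℝ) → Set ℝ
  | 0, _ => Set.Ioo (-ε) ε
  | k + 1, y => stepSet (grow ε k (fun j => y j.castSucc)) (y (Fin.last k))

lemma grow_meas (ε : ℝ) (k : ℕ) :
    MeasurableSet {p : (Fin k → ℝ) × ℝ | p.2 ∈ grow ε k p.1} := by
  induction k with
  | zero => exact measurable_snd measurableSet_Ioo
  | succ k ih =>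
    have h1 : Measurable (fun p : (Fin (k+1) → ℝ) × ℝ => ((fun j : Fin k => p.1 j.castSucc), p.2)) := by
      fun_prop
    have h2 : Measurable (fun p : (Fin (k+1) → ℝ) × ℝ =>
        ((fun j : Fin k => p.1 j.castSucc), p.2 - p.1 (Fin.last k))) := by
      fun_prop
    exact (measurable_snd meas_win).inter ((h1 ih).union (h2 ih))

lemma grow_sec (ε : ℝ) (k : ℕ) (y : Fin k → ℝ) : MeasurableSet (grow ε k y) :=
  (grow_meas ε k).preimage (show Measurable (fun z : ℝ => (y, z)) by fun_prop)

lemma grow_sub (ε : ℝ) (hε : ε < 1/2) (k : ℕ) (y : Fin k → ℝ) : grow ε k y ⊆ win := by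
  cases k with
  | zero =>
    intro z hz
    simp only [grow, Set.mem_Ioo, win, Set.mem_Icc] at *
    constructor <;> linarith [hz.1, hz.2]
  | succ k => exact fun z hz => hz.1

lemma grow_vol (ε : ℝ) (hε0 : 0 < ε) (hε : ε < 1/2) (k : ℕ) (y : Fin k → ℝ) :
    2 * ε ≤ volume.real (grow ε k y) := by
  induction k with
  | zero => simp [grow]; left; linarith
  | succ k ih =>
    refine (ih (fun j => y j.castSucc)).trans ?_
    refine measureReal_mono (fun z hz => ⟨grow_sub ε hε _ _ hz, Or.inl hz⟩) ?_
    exact ne_top_of_le_ne_top (by simp [vol_win]) (measure_mono (grow_sub ε hε (k+1) y))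

lemma grow_vol_meas (ε : ℝ) (k : ℕ) : Measurable (fun y => volume.real (grow ε k y)) :=
  (measurable_measure_prodMk_left (ν := (volume : Measure ℝ)) (grow_meas ε k)).ennreal_toReal

lemma grow_approx (ε : ℝ) (k : ℕ) (y : Fin k → ℝ) (z : ℝ) (hz : z ∈ grow ε k y) :
    ∃ t : Fin k → ℝ, (∀ j, t j = 0 ∨ t j = 1) ∧ |z - ∑ j, t j * y j| < ε := by
  induction k generalizing z with
  | zero => exact ⟨fun _ => 0, fun _ => Or.inl rfl, by simpa [abs_lt, grow] using hz⟩
  | succ k ih =>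
    rcases hz.2 with h | h
    · obtain ⟨t, ht, hd⟩ := ih _ _ h
      refine ⟨Fin.snoc t 0, fun j => ?_, ?_⟩
      · refine Fin.lastCases ?_ (fun i => ?_) j
        · simp
        · simpa using ht i
      · rw [Fin.sum_univ_castSucc]; simpa using hd
    · obtain ⟨t, ht, hd⟩ := ih _ _ h
      refine ⟨Fin.snoc t 1, fun j => ?_, ?_⟩
      · refine Fin.lastCases ?_ (fun i => ?_) j
        · simp
        · simpa using ht i
      · rw [Fin.sum_univ_castSucc]
        simp only [Fin.snoc_castSucc, Fin.snoc_last, one_mul]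
        rw [← sub_sub, sub_right_comm]; exact hd

lemma grow_exp (ν : Measure ℝ) [IsProbabilityMeasure ν]
    (hν : ENNReal.ofReal (1/4) • volume.restrict (Set.Icc (-1 : ℝ) 1) ≤ ν)
    (ε : ℝ) (hε0 : 0 < ε) (hε : ε < 1/2) (k : ℕ) :
    ∫⁻ y, ENNReal.ofReal (1 / volume.real (grow ε k y) - 1) ∂(Measure.pi fun _ : Fin k => ν)
      ≤ ENNReal.ofReal ((7/8) ^ k) * ENNReal.ofReal (1 / (2 * ε)) := by
  induction k with
  | zero =>
    calc _ ≤ ∫⁻ y, ENNReal.ofReal (1 / (2 * ε)) ∂(Measure.pi fun _ : Fin 0 => ν) := by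
          apply lintegral_mono
          intro y
          apply ENNReal.ofReal_le_ofReal
          have := one_div_le_one_div_of_le (by linarith) (grow_vol ε hε0 hε 0 y)
          linarith
      _ = _ := by simp
  | succ k ih =>
    have hmp := measurePreserving_piFinSuccAbove (fun _ : Fin (k+1) => ν) (Fin.last k)
    have hΦ : Measurable (fun q : ℝ × (Fin k → ℝ) =>
        ENNReal.ofReal (1 / volume.real (stepSet (grow ε k q.2) q.1) - 1)) := by
      have hm : Measurable (fun q : ℝ × (Fin k → ℝ) => (Fin.snoc q.2 q.1 : Fin (k+1) → ℝ)) := by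
        rw [measurable_pi_iff]
        intro j
        refine Fin.lastCases ?_ (fun i => ?_) j
        · simpa using measurable_fst
        · simp only [Fin.snoc_castSucc]; fun_prop
      have h := (grow_vol_meas ε (k+1)).comp hm
      have h' : (fun q : ℝ × (Fin k → ℝ) => volume.real (stepSet (grow ε k q.2) q.1)) =
          ((fun y => volume.real (grow ε (k+1) y)) ∘
            fun q : ℝ × (Fin k → ℝ) => (Fin.snoc q.2 q.1 : Fin (k+1) → ℝ)) := by
        funext q
        simp [grow]
      rw [← h'] at h
      exact ((h.const_div 1).sub_const 1).ennreal_ofReal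
    have e1 : ∫⁻ y, ENNReal.ofReal (1 / volume.real (grow ε (k+1) y) - 1)
          ∂(Measure.pi fun _ : Fin (k+1) => ν)
        = ∫⁻ q, ENNReal.ofReal (1 / volume.real (stepSet (grow ε k q.2) q.1) - 1)
          ∂(ν.prod (Measure.pi fun _ : Fin k => ν)) := by
      rw [← hmp.lintegral_comp hΦ]
      apply lintegral_congr
      intro y
      simp [grow, MeasurableEquiv.piFinSuccAbove, Fin.insertNthEquiv, Fin.removeNth]
      try rfl
    rw [e1, lintegral_prod_symm' _ hΦ]
    have hstep : ∀ y : Fin k → ℝ,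
        ∫⁻ x, ENNReal.ofReal (1 / volume.real (stepSet (grow ε k y) x) - 1) ∂ν
          ≤ ENNReal.ofReal (7/8) * ENNReal.ofReal (1 / volume.real (grow ε k y) - 1) := by
      intro y
      exact step_bound ν hν _ (grow_sec ε k y) (grow_sub ε hε k y)
            (lt_of_lt_of_le (by linarith) (grow_vol ε hε0 hε k y))
    have e2 := lintegral_mono (μ := Measure.pi fun _ : Fin k => ν) hstep
    rw [lintegral_const_mul' _ _ ENNReal.ofReal_ne_top] at e2
    refine e2.trans ((mul_le_mul' le_rfl ih).trans (le_of_eq ?_))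
    rw [← mul_assoc, ← ENNReal.ofReal_mul (by norm_num), pow_succ']

lemma grow_bad (ν : Measure ℝ) [IsProbabilityMeasure ν]
    (hν : ENNReal.ofReal (1/4) • volume.restrict (Set.Icc (-1 : ℝ) 1) ≤ ν)
    (ε : ℝ) (hε0 : 0 < ε) (hε : ε < 1/2) (k : ℕ) :
    (Measure.pi fun _ : Fin k => ν) {y | ε ≤ 1 / volume.real (grow ε k y) - 1}
      ≤ ENNReal.ofReal ((7/8) ^ k / (2 * ε ^ 2)) := by
  have hm : Measurable (fun y : Fin k → ℝ =>
      ENNReal.ofReal (1 / volume.real (grow ε k y) - 1)) :=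
    (((grow_vol_meas ε k).const_div 1).sub_const 1).ennreal_ofReal
  have h := mul_meas_ge_le_lintegral (μ := Measure.pi fun _ : Fin k => ν) hm (ENNReal.ofReal ε)
  have h2 := h.trans (grow_exp ν hν ε hε0 hε k)
  have hs : {y : Fin k → ℝ | ε ≤ 1 / volume.real (grow ε k y) - 1} ⊆
      {y | ENNReal.ofReal ε ≤ ENNReal.ofReal (1 / volume.real (grow ε k y) - 1)} :=
    fun y hy => ENNReal.ofReal_le_ofReal hy
  refine (measure_mono hs).trans ?_
  rw [← ENNReal.mul_le_mul_iff_right (a := ENNReal.ofReal ε) (by simpa using hε0)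
    ENNReal.ofReal_ne_top]
  refine h2.trans (le_of_eq ?_)
  rw [← ENNReal.ofReal_mul (by positivity), ← ENNReal.ofReal_mul (by positivity)]
  congr 1
  field_simp

lemma cover_of_good (ε : ℝ) (hε0 : 0 < ε) (hε : ε < 1/2) (k : ℕ) (y : Fin k → ℝ)
    (hy : 1 / volume.real (grow ε k y) - 1 < ε) (z : ℝ) (hz : z ∈ win) :
    ∃ t : Fin k → ℝ, (∀ j, t j = 0 ∨ t j = 1) ∧ |z - ∑ j, t j * y j| < 2 * ε := by
  set v := volume.real (grow ε k y) with hv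
  have hv0 : 0 < v := lt_of_lt_of_le (by linarith) (grow_vol ε hε0 hε k y)
  have hv1 : v ≤ 1 := by
    have : v ≤ volume.real win := measureReal_mono (grow_sub ε hε k y) (by simp [vol_win])
    simpa [measureReal_def, vol_win] using this
  have h1v : 1 - v < ε := by
    have : 1 < (1 + ε) * v := by
      have : 1 / v < 1 + ε := by linarith
      rwa [div_lt_iff₀ hv0] at this
    nlinarith
  have hB : volume.real (win \ grow ε k y) = 1 - v := by
    rw [measureReal_sdiff (grow_sub ε hε k y) (grow_sec ε k y) (by simp [vol_win])]
    simp [measureReal_def, vol_win, hv]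
  have hex : ∃ z' ∈ grow ε k y, |z - z'| ≤ ε := by
    by_contra! hcon
    obtain ⟨l, hl1, hl2⟩ : ∃ l, Set.Icc l (l + ε) ⊆ win ∧ Set.Icc l (l + ε) ⊆ Set.Icc (z - ε) (z + ε) := by
      simp only [win, Set.mem_Icc] at hz
      rcases le_total z 0 with h | h
      · refine ⟨z, fun x hx => ?_, fun x hx => ?_⟩ <;> simp only [win, Set.mem_Icc] at * <;>
          constructor <;> linarith [hx.1, hx.2, hz.1, hz.2]
      · refine ⟨z - ε, fun x hx => ?_, fun x hx => ?_⟩ <;> simp only [win, Set.mem_Icc] at * <;>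
          constructor <;> linarith [hx.1, hx.2, hz.1, hz.2]
    have hsub : Set.Icc l (l + ε) ⊆ win \ grow ε k y := by
      intro x hx
      refine ⟨hl1 hx, fun hx' => ?_⟩
      have h1 := hcon x hx'
      have h2 := hl2 hx
      simp only [Set.mem_Icc] at h2
      have : |z - x| ≤ ε := abs_le.2 ⟨by linarith [h2.2], by linarith [h2.1]⟩
      linarith
    have := measureReal_mono (μ := volume) hsub
      (ne_top_of_le_ne_top (by simp [vol_win]) (measure_mono Set.sdiff_subset))
    rw [hB] at this
    simp [hε0.le] at this
    linarith
  obtain ⟨z', hz', hd⟩ := hex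
  obtain ⟨t, ht, htd⟩ := grow_approx ε k y z' hz'
  refine ⟨t, ht, ?_⟩
  calc _ ≤ |z - z'| + |z' - ∑ j, t j * y j| := abs_sub_le _ _ _
    _ < _ := by linarith

lemma block_law {Ω : Type} [MeasurableSpace Ω] (P : Measure Ω) [IsProbabilityMeasure P] (b : ℝ)
    (m : ℕ) (X : Fin m × Bool → Ω → ℝ) (hX : ∀ i, Measurable (X i)) (hi : iIndepFun X P)
    (hl : ∀ i, Measure.map (X i) P = uniformIcc b (b + 1)) :
    P.map (fun ω (j : Fin m) => 2 * (X (j, true) ω - X (j, false) ω))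
      = Measure.pi fun _ : Fin m => diffLaw b := by
  set μ := uniformIcc b (b + 1) with hμ
  let Q : Measure (Fin m → ℝ × ℝ) := Measure.pi fun _ => μ.prod μ
  let u : (Fin m → ℝ × ℝ) → (Fin m × Bool → ℝ) := fun e p => if p.2 then (e p.1).1 else (e p.1).2
  have hu : Measurable u := by
    rw [measurable_pi_iff]
    rintro ⟨j, s⟩
    cases s <;> simp only [u] <;> simp <;> fun_prop
  let w : (Fin m × Bool → ℝ) → (Fin m → ℝ) := fun x j => 2 * (x (j, true) - x (j, false))
  have hw : Measurable w := by fun_prop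
  have h1 : P.map (fun ω i => X i ω) = Measure.pi fun _ : Fin m × Bool => μ := by
    rw [(iIndepFun_iff_map_fun_eq_pi_map (fun i => (hX i).aemeasurable)).1 hi]
    simp_rw [hl]
  have h2 : (Measure.pi fun _ : Fin m × Bool => μ) = Q.map u := by
    apply Measure.pi_eq
    intro s hs
    rw [Measure.map_apply hu (MeasurableSet.univ_pi hs)]
    have : u ⁻¹' (Set.univ.pi s) = Set.univ.pi (fun j => s (j, true) ×ˢ s (j, false)) := by
      ext e
      simp [u, Set.mem_pi, Prod.forall, Bool.forall_bool, and_comm]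
    rw [this, Measure.pi_pi]
    simp_rw [Measure.prod_prod]
    rw [Fintype.prod_prod_type]
    simp
  have h3 : (fun ω (j : Fin m) => 2 * (X (j, true) ω - X (j, false) ω))
      = w ∘ (fun ω i => X i ω) := rfl
  rw [h3, ← Measure.map_map hw (by fun_prop), h1, h2, Measure.map_map hw hu]
  have h4 : w ∘ u = fun e j => 2 * ((e j).1 - (e j).2) := by
    funext e j
    simp [w, u]
  rw [h4]
  exact Measure.pi_map_pi (f := fun _ (e : ℝ × ℝ) => 2 * (e.1 - e.2))
    (fun _ => Measurable.aemeasurable (by fun_prop))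

lemma block_bad {Ω : Type} [MeasurableSpace Ω] (P : Measure Ω) [IsProbabilityMeasure P] (b : ℝ)
    (m : ℕ) (X : Fin m × Bool → Ω → ℝ) (hX : ∀ i, Measurable (X i)) (hi : iIndepFun X P)
    (hl : ∀ i, Measure.map (X i) P = uniformIcc b (b + 1)) (ε : ℝ) (hε0 : 0 < ε) (hε : ε < 1/2) :
    P {ω | ¬ ∀ z ∈ win, ∃ t : Fin m → ℝ, (∀ j, t j = 0 ∨ t j = 1) ∧
        |z - ∑ j, t j * (2 * (X (j, true) ω - X (j, false) ω))| < 2 * ε}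
      ≤ ENNReal.ofReal ((7/8) ^ m / (2 * ε ^ 2)) := by
  have h := grow_bad (diffLaw b) (diffLaw_ge b) ε hε0 hε m
  rw [← block_law P b m X hX hi hl, Measure.map_apply (by fun_prop)
    (measurableSet_le measurable_const (((grow_vol_meas ε m).const_div 1).sub_const 1))] at h
  refine le_trans (measure_mono ?_) h
  intro ω hω
  by_contra hcon
  apply hω
  intro z hz
  exact cover_of_good ε hε0 hε m _ (not_le.1 hcon) z hz

lemma coarse {ι : Type*} [DecidableEq ι] (x : ι → ℝ) (M : ℝ) (hx : ∀ i, |x i| ≤ M) (s : Finset ι) (u : ℝ) :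
    ∃ a : ι → ℝ, (∀ i, a i = -1 ∨ a i = 1) ∧
      |u - ∑ i ∈ s, a i * x i| ≤ max M (|u| - ∑ i ∈ s, |x i|) := by
  induction s using Finset.induction_on generalizing u with
  | empty => exact ⟨fun _ => 1, fun _ => Or.inr rfl, by simp⟩
  | insert i s his ih =>
    obtain ⟨σ, hσ, hσu⟩ : ∃ σ : ℝ, (σ = -1 ∨ σ = 1) ∧ |u - σ * x i| ≤ max M (|u| - |x i|) := by
      have hM := hx i
      rcases le_total 0 u with hu | hu <;> rcases le_total 0 (x i) with hxi | hxi
      · refine ⟨1, Or.inr rfl, ?_⟩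
        rw [abs_of_nonneg hu, abs_of_nonneg hxi] at *
        rcases le_total (u - 1 * x i) 0 with h | h
        · rw [abs_of_nonpos h]; exact le_max_of_le_left (by linarith)
        · rw [abs_of_nonneg h]; exact le_max_of_le_right (by linarith)
      · refine ⟨-1, Or.inl rfl, ?_⟩
        rw [abs_of_nonneg hu, abs_of_nonpos hxi] at *
        rcases le_total (u - -1 * x i) 0 with h | h
        · rw [abs_of_nonpos h]; exact le_max_of_le_left (by linarith)
        · rw [abs_of_nonneg h]; exact le_max_of_le_right (by linarith)
      · refine ⟨-1, Or.inl rfl, ?_⟩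
        rw [abs_of_nonpos hu, abs_of_nonneg hxi] at *
        rcases le_total (u - -1 * x i) 0 with h | h
        · rw [abs_of_nonpos h]; exact le_max_of_le_right (by linarith)
        · rw [abs_of_nonneg h]; exact le_max_of_le_left (by linarith)
      · refine ⟨1, Or.inr rfl, ?_⟩
        rw [abs_of_nonpos hu, abs_of_nonpos hxi] at *
        rcases le_total (u - 1 * x i) 0 with h | h
        · rw [abs_of_nonpos h]; exact le_max_of_le_right (by linarith)
        · rw [abs_of_nonneg h]; exact le_max_of_le_left (by linarith)
    obtain ⟨a, ha, hd⟩ := ih (u - σ * x i)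
    refine ⟨Function.update a i σ, fun j => ?_, ?_⟩
    · by_cases hj : j = i
      · subst hj; simpa using hσ
      · simpa [hj] using ha j
    · rw [Finset.sum_insert his, Finset.sum_insert his]
      have e : ∑ j ∈ s, Function.update a i σ j * x j = ∑ j ∈ s, a j * x j := by
        apply Finset.sum_congr rfl
        intro j hj
        rw [Function.update_of_ne (by rintro rfl; exact his hj)]
      rw [e, Function.update_self, ← sub_sub]
      refine hd.trans (max_le (le_max_left _ _) ?_)
      have hs : 0 ≤ ∑ i ∈ s, |x i| := Finset.sum_nonneg fun _ _ => abs_nonneg _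
      rcases le_max_iff.1 hσu with h | h
      · exact le_max_of_le_left (by linarith)
      · exact le_max_of_le_right (by linarith)

lemma assemble (n r m : ℕ) (hr : 1 ≤ r) (x : Fin n → ℝ) (M ε : ℝ) (hx : ∀ i, |x i| ≤ M)
    (f : Fin r × (Fin m × Bool) ↪ Fin n) (hrM : 2 * M ≤ r)
    (hsum : (n : ℝ) / 5 + 4 * r * m * M ≤ ∑ i, |x i|)
    (hfine : ∀ k, ∀ z ∈ win, ∃ t : Fin m → ℝ, (∀ j, t j = 0 ∨ t j = 1) ∧
        |z - ∑ j, t j * (2 * (x (f (k, (j, true))) - x (f (k, (j, false)))))| < 2 * ε)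
    (y : ℝ) (hy : y ∈ Set.Icc (-(n : ℝ) / 5) ((n : ℝ) / 5)) :
    ∃ a : Fin n → ℝ, (∀ i, a i = -1 ∨ a i = 1) ∧ |y - ∑ i, a i * x i| < r * (2 * ε) := by
  classical
  set T : Finset (Fin n) := Finset.univ.map f with hT
  have hTsum : ∑ i ∈ T, |x i| ≤ 2 * r * m * M := by
    calc _ ≤ ∑ i ∈ T, M := Finset.sum_le_sum fun i _ => hx i
      _ = _ := by
        rw [Finset.sum_const, hT, Finset.card_map, Finset.card_univ]
        simp only [Fintype.card_prod, Fintype.card_fin, Fintype.card_bool, nsmul_eq_mul]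
        push_cast
        ring
  have hcomp : (n : ℝ) / 5 + 2 * r * m * M ≤ ∑ i ∈ Tᶜ, |x i| := by
    have := Finset.sum_add_sum_compl T (fun i => |x i|)
    linarith
  set p : ℝ := ∑ q : Fin r × Fin m, (x (f (q.1, (q.2, true))) - x (f (q.1, (q.2, false)))) with hp
  have hpb : |p| ≤ 2 * r * m * M := by
    calc |p| ≤ ∑ q : Fin r × Fin m, |x (f (q.1, (q.2, true))) - x (f (q.1, (q.2, false)))| :=
          Finset.abs_sum_le_sum_abs _ _
      _ ≤ ∑ q : Fin r × Fin m, (2 * M) := by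
          apply Finset.sum_le_sum
          intro q _
          have := abs_sub (x (f (q.1, (q.2, true)))) (x (f (q.1, (q.2, false))))
          linarith [hx (f (q.1, (q.2, true))), hx (f (q.1, (q.2, false)))]
      _ = _ := by simp; ring
  obtain ⟨a, ha, hd⟩ := coarse x M hx Tᶜ (y + p)
  have hyp : |y + p| ≤ ∑ i ∈ Tᶜ, |x i| := by
    have h1 := abs_add_le y p
    have h2 : |y| ≤ n / 5 := abs_le.2 ⟨by linarith [hy.1], hy.2⟩
    linarith
  have hr0 : (0 : ℝ) < r := by exact_mod_cast hr
  set d := y + p - ∑ i ∈ Tᶜ, a i * x i with hdd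
  have hd' : |d| ≤ r / 2 := by
    rcases le_max_iff.1 hd with h | h
    · linarith
    · linarith
  have hw : d / r ∈ win := by
    have := abs_le.1 hd'
    simp only [win, Set.mem_Icc]
    rw [div_le_iff₀ hr0, le_div_iff₀ hr0]
    constructor <;> linarith [this.1, this.2]
  choose t ht htd using fun k => hfine k (d / r) hw
  let sg : Fin r × (Fin m × Bool) → ℝ := fun q =>
    if q.2.2 then 2 * t q.1 q.2.1 - 1 else 1 - 2 * t q.1 q.2.1
  let a' : Fin n → ℝ := fun i => if h : ∃ q, f q = i then sg h.choose else a i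
  have ha'f : ∀ q, a' (f q) = sg q := by
    intro q
    have h : ∃ q', f q' = f q := ⟨q, rfl⟩
    have : h.choose = q := f.injective h.choose_spec
    simp only [a', dif_pos h, this]
  have ha'n : ∀ i ∈ Tᶜ, a' i = a i := by
    intro i hi
    have : ¬ ∃ q, f q = i := by simpa [hT] using hi
    simp only [a', dif_neg this]
  have hsg : ∀ q, sg q = -1 ∨ sg q = 1 := by
    rintro ⟨k, j, s⟩
    rcases ht k j with h | h <;> cases s <;> simp [sg, h] <;> norm_num
  refine ⟨a', fun i => ?_, ?_⟩
  · by_cases h : ∃ q, f q = i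
    · obtain ⟨q, rfl⟩ := h
      rw [ha'f]; exact hsg q
    · simp only [a', dif_neg h]; exact ha i
  · rw [← Finset.sum_add_sum_compl T, Finset.sum_congr (s₁ := Tᶜ) rfl (fun i hi => congrArg (· * x i) (ha'n i hi))]
    have e1 : ∑ i ∈ T, a' i * x i =
        (∑ k, ∑ j, t k j * (2 * (x (f (k, (j, true))) - x (f (k, (j, false)))))) - p := by
      rw [hT, Finset.sum_map, hp]
      simp_rw [ha'f]
      rw [Fintype.sum_prod_type, Fintype.sum_prod_type, ← Finset.sum_sub_distrib]
      apply Finset.sum_congr rfl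
      intro k _
      rw [Fintype.sum_prod_type, ← Finset.sum_sub_distrib]
      apply Finset.sum_congr rfl
      intro j _
      simp [sg]
      ring
    rw [e1]
    have e2 : y - ((∑ k, ∑ j, t k j * (2 * (x (f (k, (j, true))) - x (f (k, (j, false)))))) - p
        + ∑ i ∈ Tᶜ, a i * x i) =
        ∑ k : Fin r, (d / r - ∑ j, t k j * (2 * (x (f (k, (j, true))) - x (f (k, (j, false)))))) := by
      rw [Finset.sum_sub_distrib]
      simp only [Finset.sum_const, Finset.card_univ, Fintype.card_fin, nsmul_eq_mul]
      rw [mul_div_cancel₀ _ hr0.ne', hdd]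
      ring
    rw [e2]
    have : Nonempty (Fin r) := ⟨⟨0, hr⟩⟩
    calc _ ≤ ∑ k : Fin r, |d / r - ∑ j, t k j * (2 * (x (f (k, (j, true))) - x (f (k, (j, false)))))| :=
          Finset.abs_sum_le_sum_abs _ _
      _ < ∑ k : Fin r, 2 * ε :=
          Finset.sum_lt_sum_of_nonempty Finset.univ_nonempty fun k _ => htd k
      _ = _ := by simp

lemma mean_abs (b : ℝ) : 1/4 ≤ ∫ x, |x| ∂(uniformIcc b (b + 1)) := by
  rw [uniformIcc_eq, integral_Icc_eq_integral_Ioc,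
    ← intervalIntegral.integral_of_le (by linarith)]
  have hi : ∀ u v : ℝ, IntervalIntegrable (fun x : ℝ => |x|) volume u v := fun u v =>
    continuous_abs.intervalIntegrable u v
  rw [← intervalIntegral.integral_add_adjacent_intervals (hi b (b + 1/2)) (hi (b + 1/2) (b + 1))]
  have h1 : ∫ x in b..(b + 1/2), -x ≤ ∫ x in b..(b + 1/2), |x| :=
    intervalIntegral.integral_mono_on (by linarith) (continuous_neg.intervalIntegrable _ _) (hi _ _)
      (fun x _ => neg_le_abs x)
  have h2 : ∫ x in (b + 1/2)..(b + 1), x ≤ ∫ x in (b + 1/2)..(b + 1), |x| :=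
    intervalIntegral.integral_mono_on (by linarith) (continuous_id.intervalIntegrable _ _) (hi _ _)
      (fun x _ => le_abs_self x)
  rw [intervalIntegral.integral_neg, integral_id] at h1
  rw [integral_id] at h2
  nlinarith

lemma ae_bound {Ω : Type} [MeasurableSpace Ω] (P : Measure Ω) (b : ℝ)
    (X : Ω → ℝ) (hX : Measurable X) (hl : Measure.map X P = uniformIcc b (b + 1)) :
    ∀ᵐ ω ∂P, |X ω| ≤ |b| + 1 := by
  have h : ∀ᵐ x ∂(Measure.map X P), |x| ≤ |b| + 1 := by
    rw [hl, uniformIcc_eq, ae_restrict_iff' measurableSet_Icc]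
    refine Filter.Eventually.of_forall fun x hx => ?_
    rw [abs_le]
    constructor <;> linarith [hx.1, hx.2, neg_abs_le b, le_abs_self b]
  exact ae_of_ae_map hX.aemeasurable h

lemma hoeff {Ω : Type} [MeasurableSpace Ω] (P : Measure Ω) [IsProbabilityMeasure P] (b : ℝ)
    (n : ℕ) (hn : 0 < n) (X : Fin n → Ω → ℝ) (hX : ∀ i, Measurable (X i)) (hi : iIndepFun X P)
    (hl : ∀ i, Measure.map (X i) P = uniformIcc b (b + 1)) :
    P {ω | ∑ i, |X i ω| < (n : ℝ) * (9/40)} ≤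
      ENNReal.ofReal (Real.exp (-(n / (800 * (|b| + 1) ^ 2)))) := by
  set M := |b| + 1 with hM
  have hM0 : 0 < M := by positivity
  let Z : Fin n → Ω → ℝ := fun i ω => -|X i ω|
  have hZi : ∀ i, ∫ ω, Z i ω ∂P ≤ -(1/4) := by
    intro i
    have h := mean_abs b
    rw [← hl i, integral_map (hX i).aemeasurable continuous_abs.aestronglyMeasurable] at h
    simp only [Z, integral_neg]
    linarith
  have hsub : ∀ i ∈ (Finset.univ : Finset (Fin n)),
      HasSubgaussianMGF (fun ω => Z i ω - ∫ ω, Z i ω ∂P) ((‖(0:ℝ) - (-M)‖₊ / 2) ^ 2) P := by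
    intro i _
    apply hasSubgaussianMGF_of_mem_Icc (Measurable.aemeasurable (by fun_prop))
    filter_upwards [ae_bound P b (X i) (hX i) (hl i)] with ω hω
    simp only [Z, Set.mem_Icc]
    constructor <;> linarith [abs_nonneg (X i ω)]
  have hind : iIndepFun (fun i ω => Z i ω - ∫ ω, Z i ω ∂P) P :=
    hi.comp (fun i x => -|x| - ∫ ω, Z i ω ∂P) (fun i => by fun_prop)
  have h := HasSubgaussianMGF.measure_sum_ge_le_of_iIndepFun hind hsub (ε := n * (1/40)) (by positivity)
  have hs : {ω | ∑ i, |X i ω| < (n : ℝ) * (9/40)} ⊆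
      {ω | (n : ℝ) * (1/40) ≤ ∑ i, (Z i ω - ∫ ω, Z i ω ∂P)} := by
    intro ω hω
    simp only [Set.mem_ofPred_eq] at *
    rw [Finset.sum_sub_distrib]
    have h1 : ∑ i, ∫ ω, Z i ω ∂P ≤ ∑ i : Fin n, (-(1/4) : ℝ) := Finset.sum_le_sum fun i _ => hZi i
    have h2 : ∑ i, Z i ω = - ∑ i, |X i ω| := by simp [Z]
    simp at h1
    rw [h2]
    linarith
  refine (measure_mono hs).trans ?_
  rw [← ofReal_measureReal]
  apply ENNReal.ofReal_le_ofReal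
  refine h.trans ?_
  rw [Real.exp_le_exp]
  have hn' : (0 : ℝ) < n := by exact_mod_cast hn
  simp only [Finset.sum_const, Finset.card_univ, Fintype.card_fin, nsmul_eq_mul]
  push_cast
  rw [zero_sub, neg_neg, Real.norm_of_nonneg hM0.le]
  apply le_of_eq
  field_simp
  norm_num

lemma main_bound {Ω : Type} [MeasurableSpace Ω] (P : Measure Ω) [IsProbabilityMeasure P] (b : ℝ)
    (n : ℕ) (hn : 0 < n) (X : Fin n → Ω → ℝ) (hX : ∀ i, Measurable (X i)) (hi : iIndepFun X P)
    (hl : ∀ i, Measure.map (X i) P = uniformIcc b (b + 1))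
    (r m : ℕ) (hr : 1 ≤ r) (hrM : 2 * (|b| + 1) ≤ r) (hm : 160 * r * (|b| + 1) * m ≤ n)
    (e : ℝ) (he0 : 0 < e) (he : (2 * r + 1) * e < 1) (h78 : ((7:ℝ)/8) ^ m ≤ e ^ 8)
    (hexp : Real.exp (-(n / (800 * (|b| + 1) ^ 2))) ≤ e ^ 8) :
    ENNReal.ofReal (1 - e) ≤ P {ω | ∀ x ∈ Set.Icc (-(n : ℝ) / 5) ((n : ℝ) / 5),
                ∃ a : Fin n → ℝ, (∀ i, a i = -1 ∨ a i = 1) ∧ |x - ∑ i, a i * X i ω| < e} := by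
  set G := {ω | ∀ x ∈ Set.Icc (-(n : ℝ) / 5) ((n : ℝ) / 5),
                ∃ a : Fin n → ℝ, (∀ i, a i = -1 ∨ a i = 1) ∧ |x - ∑ i, a i * X i ω| < e} with hG
  set M := |b| + 1 with hM
  have hM1 : 1 ≤ M := by have := abs_nonneg b; linarith
  have hr1 : (1 : ℝ) ≤ r := by exact_mod_cast hr
  have he3 : e < 1/3 := by nlinarith
  have hε0 : 0 < e ^ 2 := by positivity
  have hε : e ^ 2 < 1/2 := by nlinarith
  have hcard : Fintype.card (Fin r × (Fin m × Bool)) ≤ Fintype.card (Fin n) := by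
    simp only [Fintype.card_prod, Fintype.card_fin, Fintype.card_bool]
    have h0 : (0:ℝ) ≤ r * m := by positivity
    have : ((r * (m * 2) : ℕ) : ℝ) ≤ n := by
      push_cast
      nlinarith [mul_nonneg h0 (sub_nonneg.2 hM1)]
    exact_mod_cast this
  obtain ⟨f⟩ := Function.Embedding.nonempty_of_card_le hcard
  let E1 := {ω | ∑ i, |X i ω| < (n : ℝ) * (9/40)}
  let E2 := {ω | ¬ ∀ i, |X i ω| ≤ M}
  let E3 : Fin r → Set Ω := fun k => {ω | ¬ ∀ z ∈ win, ∃ t : Fin m → ℝ, (∀ j, t j = 0 ∨ t j = 1) ∧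
        |z - ∑ j, t j * (2 * (X (f (k, (j, true))) ω - X (f (k, (j, false))) ω))| < 2 * e ^ 2}
  have h1 : P E1 ≤ ENNReal.ofReal (e ^ 8) :=
    (hoeff P b n hn X hX hi hl).trans (ENNReal.ofReal_le_ofReal hexp)
  have h2 : P E2 = 0 := by
    have : ∀ᵐ ω ∂P, ∀ i, |X i ω| ≤ M := ae_all_iff.2 fun i => ae_bound P b (X i) (hX i) (hl i)
    exact this
  have h3 : ∀ k, P (E3 k) ≤ ENNReal.ofReal (e ^ 4 / 2) := by
    intro k
    have hinj : Function.Injective (fun i : Fin m × Bool => f (k, i)) := by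
      intro i j hij
      have := f.injective hij
      simpa using this
    refine (block_bad P b m (fun i => X (f (k, i))) (fun i => hX _)
      (hi.precomp hinj) (fun i => hl _) (e ^ 2) hε0 hε).trans (ENNReal.ofReal_le_ofReal ?_)
    rw [div_le_div_iff₀ (by positivity) (by norm_num)]
    calc _ ≤ e ^ 8 * 2 := by gcongr
      _ = _ := by ring
  have hsub : Gᶜ ⊆ E1 ∪ E2 ∪ ⋃ k, E3 k := by
    intro ω hω
    by_contra hcon
    simp only [Set.mem_union, Set.mem_iUnion, not_or, not_exists] at hcon
    obtain ⟨⟨c1, c2⟩, c3⟩ := hcon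
    apply hω
    intro y hy
    have c1' : (n : ℝ) * (9/40) ≤ ∑ i, |X i ω| := not_lt.1 c1
    have c2' : ∀ i, |X i ω| ≤ M := not_not.1 c2
    have c3' := fun k => not_not.1 (c3 k)
    obtain ⟨a, ha, hd⟩ := assemble n r m hr (fun i => X i ω) M (e ^ 2) c2' f hrM
      (by linarith) c3' y hy
    exact ⟨a, ha, hd.trans (by nlinarith)⟩
  have hbad : P Gᶜ ≤ ENNReal.ofReal e := by
    calc P Gᶜ ≤ P (E1 ∪ E2 ∪ ⋃ k, E3 k) := measure_mono hsub
      _ ≤ P E1 + P E2 + ∑ k, P (E3 k) := by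
        refine (measure_union_le _ _).trans (add_le_add (measure_union_le _ _) ?_)
        exact measure_iUnion_fintype_le P E3
      _ ≤ ENNReal.ofReal (e ^ 8) + 0 + ∑ k : Fin r, ENNReal.ofReal (e ^ 4 / 2) := by
        gcongr
        · exact h2.le
        · exact h3 _
      _ = ENNReal.ofReal (e ^ 8 + r * (e ^ 4 / 2)) := by
        rw [add_zero, Finset.sum_const, Finset.card_univ, Fintype.card_fin, nsmul_eq_mul,
          ENNReal.ofReal_add (by positivity) (by positivity), ENNReal.ofReal_mul (by positivity),
          ENNReal.ofReal_natCast]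
      _ ≤ _ := by
        apply ENNReal.ofReal_le_ofReal
        have a1 : e ^ 8 ≤ e ^ 2 := pow_le_pow_of_le_one he0.le (by linarith) (by norm_num)
        have a2 : e ^ 4 ≤ e ^ 2 := pow_le_pow_of_le_one he0.le (by linarith) (by norm_num)
        nlinarith
  rw [ENNReal.ofReal_sub _ he0.le, ENNReal.ofReal_one, tsub_le_iff_right]
  calc 1 = P Set.univ := by simp
    _ = P (G ∪ Gᶜ) := by rw [Set.union_compl_self]
    _ ≤ P G + P Gᶜ := measure_union_le _ _
    _ ≤ _ := by gcongr

/-- For every real `b` there is `c > 0` such that for all sufficiently large `n`,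
if `X₁, …, Xₙ` are independent uniform random variables on `[b, b+1]`, then with probability at
least `1 − 2^{−cn}` every `x ∈ [−n/5, n/5]` is within `2^{−cn}` of some `±1`-combination
`Σ aᵢ Xᵢ`. -/
theorem dense_linear_combinations_of_uniform (b : ℝ) :
    ∃ c : ℝ, 0 < c ∧ ∃ N : ℕ, ∀ n : ℕ, N ≤ n →
      ∀ (Ω : Type) (_ : MeasurableSpace Ω) (P : Measure Ω), IsProbabilityMeasure P →
        ∀ X : Fin n → Ω → ℝ,
          (∀ i, Measurable (X i)) →
          iIndepFun X P →
          (∀ i, Measure.map (X i) P = uniformIcc b (b + 1)) →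
          ENNReal.ofReal (1 - 2 ^ (-(c * n))) ≤
            P {ω | ∀ x ∈ Set.Icc (-(n : ℝ) / 5) ((n : ℝ) / 5),
                ∃ a : Fin n → ℝ, (∀ i, a i = -1 ∨ a i = 1) ∧
                  |x - ∑ i, a i * X i ω| < 2 ^ (-(c * n))} := by
  set M := |b| + 1 with hM
  have hM1 : 1 ≤ M := by have := abs_nonneg b; linarith
  set r := ⌈2 * M⌉₊ with hr
  have hrM : 2 * M ≤ r := Nat.le_ceil _
  have hr1' : (1 : ℝ) ≤ r := by linarith
  have hr1 : 1 ≤ r := by exact_mod_cast hr1'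
  set q := ⌈160 * r * M⌉₊ with hq
  have hqM : 160 * r * M ≤ q := Nat.le_ceil _
  have hq0 : (0 : ℝ) < q := lt_of_lt_of_le (by positivity) hqM
  have hl2 : 0 < Real.log 2 := Real.log_pos (by norm_num)
  have hl87 : 0 < Real.log (8/7) := Real.log_pos (by norm_num)
  set c := min (1 / (6400 * M ^ 2 * Real.log 2)) (Real.log (8/7) / (16 * q * Real.log 2)) with hc
  have hc0 : 0 < c := lt_min (by positivity) (by positivity)
  have hc1 : 8 * (c * Real.log 2) ≤ 1 / (800 * M ^ 2) := by
    have : c ≤ 1 / (6400 * M ^ 2 * Real.log 2) := min_le_left _ _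
    calc 8 * (c * Real.log 2) ≤ 8 * (1 / (6400 * M ^ 2 * Real.log 2) * Real.log 2) := by gcongr
      _ = _ := by field_simp; norm_num
  have hc2 : 8 * (c * Real.log 2) ≤ Real.log (8/7) / (2 * q) := by
    have : c ≤ Real.log (8/7) / (16 * q * Real.log 2) := min_le_right _ _
    calc 8 * (c * Real.log 2) ≤ 8 * (Real.log (8/7) / (16 * q * Real.log 2) * Real.log 2) := by
          gcongr
      _ = _ := by field_simp; norm_num
  refine ⟨c, hc0, max (2 * q) ⌈(2 * r + 1) / (c * Real.log 2)⌉₊, ?_⟩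
  intro n hn Ω _ P hP X hX hi hl
  have hn1 : ((2 * q : ℕ) : ℝ) ≤ n := by exact_mod_cast (le_max_left _ _).trans hn
  push_cast at hn1
  have hn2 : (2 * r + 1) / (c * Real.log 2) ≤ n :=
    (Nat.le_ceil _).trans (by exact_mod_cast (le_max_right _ _).trans hn)
  have hn0 : (0 : ℝ) < n := by linarith
  have hqn : 0 < q := by exact_mod_cast hq0
  have hmle : ((n / q : ℕ) : ℝ) * q ≤ n := by exact_mod_cast Nat.div_mul_le_self n q
  have hmge : (n : ℝ) ≤ ((n / q : ℕ) : ℝ) * (2 * q) := by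
    have h := Nat.lt_div_mul_add hqn (a := n)
    have h' : (n : ℝ) < ((n / q : ℕ) : ℝ) * q + q := by exact_mod_cast h
    linarith
  have heq : (2 : ℝ) ^ (-(c * n)) = Real.exp (-(c * Real.log 2 * n)) := by
    rw [Real.rpow_def_of_pos (by norm_num)]
    congr 1; ring
  have hpow : Real.exp (-(c * Real.log 2 * n)) ^ 8 = Real.exp (-(8 * (c * Real.log 2) * n)) := by
    rw [← Real.exp_nat_mul]
    congr 1; push_cast; ring
  refine main_bound P b n (by exact_mod_cast hn0) X hX hi hl r (n / q) hr1 hrM ?_ _ (by positivity)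
    ?_ ?_ ?_
  · calc 160 * r * (|b| + 1) * ((n / q : ℕ) : ℝ) ≤ q * ((n / q : ℕ) : ℝ) := by gcongr
      _ ≤ n := by linarith
  · rw [heq, Real.exp_neg, ← div_eq_mul_inv, div_lt_one (Real.exp_pos _)]
    rw [div_le_iff₀ (by positivity)] at hn2
    have := Real.add_one_le_exp (c * Real.log 2 * n)
    linarith
  · rw [heq, hpow]
    have h78 : ((7:ℝ)/8) = Real.exp (-Real.log (8/7)) := by
      rw [Real.exp_neg, Real.exp_log (by norm_num)]; norm_num
    rw [h78, ← Real.exp_nat_mul, Real.exp_le_exp]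
    have : 8 * (c * Real.log 2) * n ≤ Real.log (8/7) / (2 * q) * (((n / q : ℕ) : ℝ) * (2 * q)) := by
      gcongr
    have e : Real.log (8/7) / (2 * q) * (((n / q : ℕ) : ℝ) * (2 * q))
        = ((n / q : ℕ) : ℝ) * Real.log (8/7) := by field_simp
    linarith
  · rw [heq, hpow, Real.exp_le_exp]
    have : 8 * (c * Real.log 2) * n ≤ 1 / (800 * M ^ 2) * n := by gcongr
    have e : 1 / (800 * M ^ 2) * n = n / (800 * M ^ 2) := by ring
    linarith
end
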